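/- arXiv:1903.00541 — 4 statements merged into one kernel-verified Lean document; each statement's English description precedes it below -/
import Mathlib

section
/- Let 1 ≤ p < q ≤ ∞ with 1/p = 1/q + 1/s, and let σ = (σ_k)_{k≥1} be a non-increasing sequence of positive real numbers with σ_k → 0. Assume condition (EXP): there exists a real number b > 1 such that sup{ σ_n b^n / (σ_k b^k) : (n,k) ∈ ℕ², k ≤ n } < ∞. Then there exist constants c₁, c₂ > 0 such that for all n ≥ 1, c₁ · sup_{k≥1} k^{-1/s} (σ_1·σ_2·…·σ_k / n)^{1/k} ≤ e_n(D_σ) ≤ c₂ · sup_{k≥1} k^{-1/s} (σ_1·σ_2·…·σ_k / n)^{1/k}, where e_n(D_σ) is the n-th entropy number of the diagonal operator D_σ : ℓ_p → ℓ_q. -/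
open Metric Filter
open scoped ENNReal

/-- The `n`-th (inner) entropy number of a set `T` in a normed space: the infimum of all
`ε > 0` such that `T` can be covered by `n` closed balls of radius `ε`. -/
noncomputable def entropyNumber {Y : Type*} [SeminormedAddCommGroup Y]
    (n : ℕ) (T : Set Y) : ℝ :=
  sInf {ε : ℝ | 0 < ε ∧ ∃ y : Fin n → Y, T ⊆ ⋃ i, Metric.closedBall (y i) ε}

lemma oneD (t : ℝ) (ht : 0 < t) (ht1 : t ≤ 1) (y : ℝ) (F : Finset ℤ) :
    ∑ m ∈ F, Real.exp (-(t * |(m:ℝ) - y|)) ≤ 12 / t := by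
  set r := Real.exp (-t) with hr
  have hr0 : 0 < r := Real.exp_pos _
  have hr1 : r * (1 + t) ≤ 1 := by
    have h1 : t + 1 ≤ Real.exp t := Real.add_one_le_exp t
    have h2 : r * Real.exp t = 1 := by rw [hr, ← Real.exp_add]; simp
    nlinarith
  have hr2 : r < 1 := by nlinarith
  have hs1 := hasSum_geometric_of_lt_one hr0.le hr2
  have hs2 := hs1.mul_left r
  have hsum : HasSum (fun j : ℤ => Real.exp (-(t * |(j:ℝ)|))) ((1 - r)⁻¹ + r * (1 - r)⁻¹) := by
    apply HasSum.of_nat_of_neg_add_one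
    · convert hs1 using 2 with n
      rw [hr, ← Real.exp_nat_mul]; congr 1
      simp; ring
    · have e : (fun n : ℕ => Real.exp (-(t * |((-((n:ℤ) + 1) : ℤ) : ℝ)|))) = fun i => r * r ^ i := by
        funext n
        rw [← pow_succ', hr, ← Real.exp_nat_mul]; congr 1
        push_cast
        rw [abs_neg, abs_of_nonneg (by positivity)]; ring
      rw [e]; exact hs2
  have he : Real.exp 1 ≤ 3 := by have := Real.exp_one_lt_d9; linarith
  have hval : (1 - r)⁻¹ + r * (1 - r)⁻¹ ≤ 4 / t := by
    have h3 : 0 < 1 - r := by linarith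
    rw [show (1 - r)⁻¹ + r * (1 - r)⁻¹ = (1 + r) / (1 - r) by field_simp,
      div_le_div_iff₀ h3 ht]
    nlinarith
  calc ∑ m ∈ F, Real.exp (-(t * |(m:ℝ) - y|))
      ≤ ∑ m ∈ F, 3 * Real.exp (-(t * |((m - ⌊y⌋ : ℤ):ℝ)|)) := by
        apply Finset.sum_le_sum
        intro m _
        refine le_trans ?_ (mul_le_mul_of_nonneg_right he (Real.exp_pos _).le)
        rw [← Real.exp_add]
        apply Real.exp_le_exp.2
        have h1 := Int.floor_le y
        have h2 := Int.lt_floor_add_one y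
        have : |((m - ⌊y⌋ : ℤ):ℝ)| ≤ |(m:ℝ) - y| + 1 := by
          push_cast
          calc |(m:ℝ) - ⌊y⌋| = |((m:ℝ) - y) + (y - ⌊y⌋)| := by ring_nf
            _ ≤ |(m:ℝ) - y| + |y - ⌊y⌋| := abs_add_le _ _
            _ ≤ _ := by
              gcongr
              rw [abs_le]; constructor <;> linarith
        nlinarith
    _ = 3 * ∑ j ∈ F.image (fun m => m - ⌊y⌋), Real.exp (-(t * |(j:ℝ)|)) := by
        rw [Finset.sum_image (by intro a _ b _ h; simpa using h), Finset.mul_sum]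
    _ ≤ 3 * (4 / t) := by
        gcongr
        exact (sum_le_hasSum _ (fun _ _ => (Real.exp_pos _).le) hsum).trans hval
    _ = 12 / t := by ring

lemma countL {N : ℕ} (t y : Fin N → ℝ) (ht : ∀ i, 0 < t i) (ht1 : ∀ i, t i ≤ 1)
    (S : Finset (Fin N → ℤ)) (hS : ∀ m ∈ S, ∑ i, t i * |(m i : ℝ) - y i| ≤ 2 * N) :
    (S.card : ℝ) ≤ ∏ i, (108 / t i) := by
  classical
  have he : Real.exp 2 ≤ 9 := by
    have := Real.exp_one_lt_d9
    have h2 : Real.exp 2 = Real.exp 1 * Real.exp 1 := by rw [← Real.exp_add]; norm_num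
    have := Real.exp_pos 1
    nlinarith
  calc (S.card : ℝ) = ∑ m ∈ S, (1:ℝ) := by simp
    _ ≤ ∑ m ∈ S, ∏ i, (Real.exp 2 * Real.exp (-(t i * |(m i : ℝ) - y i|))) := by
        apply Finset.sum_le_sum
        intro m hm
        simp_rw [← Real.exp_add]
        rw [← Real.exp_sum, Finset.sum_add_distrib, Finset.sum_neg_distrib]
        apply Real.one_le_exp
        have := hS m hm
        simp; linarith
    _ ≤ ∑ m ∈ Fintype.piFinset (fun i => S.image (fun m : Fin N → ℤ => m i)),
          ∏ i, (Real.exp 2 * Real.exp (-(t i * |(m i : ℝ) - y i|))) := by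
        apply Finset.sum_le_sum_of_subset_of_nonneg
        · intro m hm
          rw [Fintype.mem_piFinset]
          intro i
          exact Finset.mem_image_of_mem _ hm
        · intros; positivity
    _ = ∏ i, ∑ j ∈ S.image (fun m : Fin N → ℤ => m i), (Real.exp 2 * Real.exp (-(t i * |(j : ℝ) - y i|))) := by
        rw [Finset.prod_univ_sum]
    _ ≤ ∏ i, (108 / t i) := by
        apply Finset.prod_le_prod
        · intros; positivity
        · intro i _
          rw [← Finset.mul_sum]
          calc _ ≤ 9 * (12 / t i) := by
                gcongr
                exact oneD _ (ht i) (ht1 i) _ _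
            _ = _ := by ring

lemma lemA (p : ℝ≥0∞) [Fact (1 ≤ p)] (x : lp (fun _ : ℕ => ℝ) p) (k : ℕ) (hk : 1 ≤ k) :
    ∑ i ∈ Finset.range k, |x i| ≤ (k:ℝ) ^ (1 - (1 / p).toReal) * ‖x‖ := by
  have hk0 : (0:ℝ) < k := by exact_mod_cast hk
  have hp1 : 1 ≤ p := Fact.out
  rcases eq_or_ne p ∞ with rfl | hp
  · simp only [one_div, ENNReal.inv_top, ENNReal.toReal_zero, sub_zero, Real.rpow_one]
    calc _ ≤ ∑ i ∈ Finset.range k, ‖x‖ :=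
          Finset.sum_le_sum fun i _ => lp.norm_apply_le_norm (by simp) x i
      _ = _ := by simp
  · have hr : 1 ≤ p.toReal := by
      rw [← ENNReal.toReal_one]; exact ENNReal.toReal_mono hp hp1
    have hr0 : 0 < p.toReal := by linarith
    have h1 := Real.rpow_sum_le_const_mul_sum_rpow (Finset.range k) (fun i => x i) hr
    have h2 := lp.sum_rpow_le_norm_rpow hr0 x (Finset.range k)
    simp only [Real.norm_eq_abs] at h2
    rw [Finset.card_range] at h1
    have h3 : (∑ i ∈ Finset.range k, |x i|) ^ p.toReal ≤ (k:ℝ) ^ (p.toReal - 1) * ‖x‖ ^ p.toReal :=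
      h1.trans (by gcongr)
    rw [← Real.rpow_le_rpow_iff (by positivity) (by positivity) hr0,
      Real.mul_rpow (by positivity) (by positivity), ← Real.rpow_mul hk0.le]
    convert h3 using 3
    simp; field_simp

lemma lemB (p : ℝ≥0∞) [Fact (1 ≤ p)] (x : lp (fun _ : ℕ => ℝ) p) (k : ℕ) (hk : 1 ≤ k) (c : ℝ)
    (hc : 0 ≤ c) (h1 : ∀ i < k, |x i| ≤ c) (h2 : ∀ i, k ≤ i → x i = 0) :
    ‖x‖ ≤ (k:ℝ) ^ ((1 / p).toReal) * c := by
  have hk0 : (0:ℝ) < k := by exact_mod_cast hk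
  have hp1 : 1 ≤ p := Fact.out
  have h3 : ∀ i, |x i| ≤ c := fun i => by
    rcases lt_or_ge i k with h | h
    · exact h1 i h
    · rw [h2 i h]; simpa
  rcases eq_or_ne p ∞ with rfl | hp
  · simp only [one_div, ENNReal.inv_top, ENNReal.toReal_zero, Real.rpow_zero, one_mul]
    exact lp.norm_le_of_forall_le hc h3
  · have hr : 1 ≤ p.toReal := by
      rw [← ENNReal.toReal_one]; exact ENNReal.toReal_mono hp hp1
    have hr0 : 0 < p.toReal := by linarith
    apply lp.norm_le_of_forall_sum_le hr0 (by positivity)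
    intro s
    rw [Real.mul_rpow (by positivity) (by positivity), ← Real.rpow_mul hk0.le]
    calc ∑ i ∈ s, ‖x i‖ ^ p.toReal ≤ ∑ i ∈ Finset.range k, ‖x i‖ ^ p.toReal := by
          have hz : ∀ i, i ∉ Finset.range k → ‖x i‖ ^ p.toReal = 0 := by
            intro i h
            rw [h2 i (by simpa using h)]
            simp [hr0.ne']
          rw [← Finset.sum_filter_of_ne (s := s) (p := fun i => i ∈ Finset.range k)
            (fun i _ hi => by by_contra h; exact hi (hz i h))]
          apply Finset.sum_le_sum_of_subset_of_nonneg
          · intro i hi; exact (Finset.mem_filter.1 hi).2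
          · intros; positivity
      _ ≤ ∑ i ∈ Finset.range k, c ^ p.toReal :=
          Finset.sum_le_sum fun i _ => Real.rpow_le_rpow (norm_nonneg _) (h3 i) hr0.le
      _ = _ := by simp [hr0.ne']

lemma lemE (p q : ℝ≥0∞) [Fact (1 ≤ p)] [Fact (1 ≤ q)] (hpq : p < q)
    (x : lp (fun _ : ℕ => ℝ) p) (hx : ‖x‖ ≤ 1) (z : lp (fun _ : ℕ => ℝ) q)
    (k L : ℕ) (ε : ℝ) (hε : 0 < ε)
    (h1 : ∀ i < k, |z i| ≤ ε * (k:ℝ) ^ (-(1 / q).toReal))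
    (h2 : ∀ i, k ≤ i → i < k + L → |z i| ≤ ε / L)
    (h3 : ∀ i, k + L ≤ i → |z i| ≤ ε * |x i|) : ‖z‖ ≤ 3 * ε := by
  have hp1 : 1 ≤ p := Fact.out
  have hq1 : 1 ≤ q := Fact.out
  have hxi : ∀ i, |x i| ≤ 1 := fun i =>
    (lp.norm_apply_le_norm (by rintro rfl; simp at hp1) x i).trans hx
  rcases eq_or_ne q ∞ with rfl | hq
  · apply lp.norm_le_of_forall_le (by positivity)
    intro i
    rw [Real.norm_eq_abs]
    refine le_trans (b := ε) ?_ (by linarith)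
    rcases lt_or_ge i k with h | h
    · simpa using h1 i h
    rcases lt_or_ge i (k + L) with h' | h'
    · refine (h2 i h h').trans (div_le_self hε.le ?_)
      have : 1 ≤ L := by omega
      exact Nat.one_le_cast.2 this
    · exact (h3 i h').trans (by have := hxi i; nlinarith)
  · have hr : 1 ≤ q.toReal := by
      rw [← ENNReal.toReal_one]; exact ENNReal.toReal_mono hq hq1
    have hr0 : 0 < q.toReal := by linarith
    have hp : p ≠ ∞ := hpq.ne_top
    have hpr : 1 ≤ p.toReal := by
      rw [← ENNReal.toReal_one]; exact ENNReal.toReal_mono hp hp1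
    have hpqr : p.toReal ≤ q.toReal := ENNReal.toReal_mono hq hpq.le
    apply lp.norm_le_of_forall_sum_le hr0 (by positivity)
    intro s
    set E := ε ^ q.toReal with hE
    have hE0 : 0 < E := by positivity
    have key : ∀ i, ‖z i‖ ^ q.toReal ≤ (if i < k then E / k else 0) +
        (if k ≤ i ∧ i < k + L then E / L else 0) + E * ‖x i‖ ^ p.toReal := by
      intro i
      have n3 : 0 ≤ E * ‖x i‖ ^ p.toReal := by positivity
      rcases lt_or_ge i k with h | h
      · have hk : (0:ℝ) < k := by exact_mod_cast (by omega : 0 < k)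
        have := Real.rpow_le_rpow (abs_nonneg _) (h1 i h) hr0.le
        rw [Real.mul_rpow hε.le (by positivity), ← Real.rpow_mul hk.le] at this
        have e : -(1 / q).toReal * q.toReal = -1 := by simp [hr0.ne']
        rw [e, Real.rpow_neg_one] at this
        rw [if_pos h, if_neg (by omega), Real.norm_eq_abs]
        rw [div_eq_mul_inv]; linarith
      rcases lt_or_ge i (k + L) with h' | h'
      · have hL : (1:ℝ) ≤ L := by exact_mod_cast (by omega : 1 ≤ L)
        have := Real.rpow_le_rpow (abs_nonneg _) (h2 i h h') hr0.le
        rw [Real.div_rpow hε.le (by positivity)] at this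
        rw [if_neg (by omega), if_pos ⟨h, h'⟩, Real.norm_eq_abs]
        have h5 : (L:ℝ) ≤ (L:ℝ) ^ q.toReal := by
          simpa using Real.rpow_le_rpow_of_exponent_le hL hr
        have : E / (L:ℝ) ^ q.toReal ≤ E / L := by gcongr
        linarith
      · have := Real.rpow_le_rpow (abs_nonneg _) (h3 i h') hr0.le
        rw [Real.mul_rpow hε.le (by positivity)] at this
        rw [if_neg (by omega), if_neg (by omega), Real.norm_eq_abs, Real.norm_eq_abs]
        have h6 : |x i| ^ q.toReal ≤ |x i| ^ p.toReal := by
          rcases eq_or_lt_of_le (abs_nonneg (x i)) with h0 | h0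
          · rw [← h0, Real.zero_rpow (by linarith), Real.zero_rpow (by linarith)]
          · exact Real.rpow_le_rpow_of_exponent_ge h0 (hxi i) hpqr
        have : E * |x i| ^ q.toReal ≤ E * |x i| ^ p.toReal := by gcongr
        linarith
    have s1 : ∑ i ∈ s, (if i < k then E / k else 0) ≤ E := by
      rw [← Finset.sum_filter, Finset.sum_const, nsmul_eq_mul]
      have hc : (s.filter (fun i => i < k)).card ≤ k := by
        calc _ ≤ (Finset.range k).card := Finset.card_le_card (by intro i; simp)
          _ = k := by simp
      rcases Nat.eq_zero_or_pos k with h0 | h0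
      · subst h0; simp; exact hE0.le
      · have hk : (0:ℝ) < k := by exact_mod_cast h0
        calc _ ≤ (k:ℝ) * (E / k) := by gcongr
          _ = E := by field_simp
    have s2 : ∑ i ∈ s, (if k ≤ i ∧ i < k + L then E / L else 0) ≤ E := by
      rw [← Finset.sum_filter, Finset.sum_const, nsmul_eq_mul]
      have hc : (s.filter (fun i => k ≤ i ∧ i < k + L)).card ≤ L := by
        calc _ ≤ (Finset.Ico k (k+L)).card := Finset.card_le_card (by intro i; simp)
          _ = L := by simp
      rcases Nat.eq_zero_or_pos L with h0 | h0
      · subst h0; simp; exact hE0.le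
      · have hk : (0:ℝ) < L := by exact_mod_cast h0
        calc _ ≤ (L:ℝ) * (E / L) := by gcongr
          _ = E := by field_simp
    have s3 : ∑ i ∈ s, E * ‖x i‖ ^ p.toReal ≤ E := by
      rw [← Finset.mul_sum]
      have := lp.sum_rpow_le_norm_rpow (by linarith) x s
      have h7 : ‖x‖ ^ p.toReal ≤ 1 := Real.rpow_le_one (norm_nonneg _) hx (by linarith)
      nlinarith
    calc _ ≤ ∑ i ∈ s, _ := Finset.sum_le_sum fun i _ => key i
      _ ≤ 3 * E := by
        rw [Finset.sum_add_distrib, Finset.sum_add_distrib]; linarith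
      _ ≤ (3 * ε) ^ q.toReal := by
        rw [Real.mul_rpow (by norm_num) hε.le]
        gcongr
        simpa using Real.rpow_le_rpow_of_exponent_le (by norm_num : (1:ℝ) ≤ 3) hr

lemma mem_fin {N : ℕ} (f : Fin N → ℝ) (p : ℝ≥0∞) :
    Memℓp (E := fun _ : ℕ => ℝ) (fun i => if h : i < N then f ⟨i, h⟩ else 0) p := by
  refine Memℓp.of_exponent_ge (memℓp_zero ?_) zero_le
  apply (Set.finite_lt_nat N).subset
  intro i hi
  by_contra h
  apply hi
  have h' : ¬ i < N := h
  simp [h']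

noncomputable def mkv {N : ℕ} (f : Fin N → ℝ) (p : ℝ≥0∞) : lp (fun _ : ℕ => ℝ) p :=
  ⟨_, mem_fin f p⟩

lemma mkv_lt {N : ℕ} (f : Fin N → ℝ) (p : ℝ≥0∞) (i : ℕ) (h : i < N) : mkv f p i = f ⟨i, h⟩ := by
  change (if h : i < N then f ⟨i, h⟩ else 0) = _
  rw [dif_pos h]

lemma mkv_ge {N : ℕ} (f : Fin N → ℝ) (p : ℝ≥0∞) (i : ℕ) (h : N ≤ i) : mkv f p i = 0 := by
  change (if h : i < N then f ⟨i, h⟩ else 0) = _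
  rw [dif_neg (by omega)]

lemma lowerL (p q : ℝ≥0∞) [Fact (1 ≤ p)] [Fact (1 ≤ q)] (a : ℝ)
    (ha : (1 / p).toReal = (1 / q).toReal + a)
    (σ : ℕ → ℝ) (hσpos : ∀ k, 0 < σ k)
    (D : lp (fun _ : ℕ => ℝ) p →L[ℝ] lp (fun _ : ℕ => ℝ) q)
    (hD : ∀ (x : lp (fun _ : ℕ => ℝ) p) (k : ℕ), D x k = σ k * x k)
    (n : ℕ) (hn : 1 ≤ n) (ε : ℝ) (hε : 0 < ε) (y : Fin n → lp (fun _ : ℕ => ℝ) q)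
    (hy : D '' Metric.closedBall 0 1 ⊆ ⋃ i, Metric.closedBall (y i) ε) (k : ℕ) :
    (k + 1 : ℝ) ^ (-a) *
          ((∏ i ∈ Finset.range (k + 1), σ i) / n) ^ (1 / (k + 1 : ℝ)) ≤ 108 * ε := by
  classical
  have hn0 : (0:ℝ) < n := by exact_mod_cast hn
  obtain ⟨N, hN⟩ : ∃ N, N = k + 1 := ⟨_, rfl⟩
  have hNr : (k + 1 : ℝ) = N := by rw [hN]; push_cast; rfl
  have hN1 : 1 ≤ N := by omega
  rw [hNr, ← hN]
  have hN0 : (0:ℝ) < N := by exact_mod_cast hN1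
  set P := ∏ i ∈ Finset.range N, σ i with hP
  have hP0 : 0 < P := Finset.prod_pos fun i _ => hσpos i
  set δ : ℝ := ε * (N:ℝ) ^ (-(1 / q).toReal) with hδ
  have hδ0 : 0 < δ := by positivity
  set c : ℝ := (N:ℝ) ^ (-(1 / p).toReal) with hc
  have hc0 : 0 < c := by positivity
  let R : Fin N → ℤ := fun i => ⌊σ i * c / δ⌋
  have hR0 : ∀ i, 0 ≤ R i := fun i => Int.floor_nonneg.2 (by have := hσpos i; positivity)
  let S := Fintype.piFinset (fun i => Finset.Icc (-R i) (R i))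
  have hcard : P * ((N:ℝ) ^ (-a) / ε) ^ N ≤ S.card := by
    simp only [S, Fintype.card_piFinset, Int.card_Icc]
    push_cast
    calc P * ((N:ℝ) ^ (-a) / ε) ^ N = ∏ i : Fin N, (σ i * ((N:ℝ) ^ (-a) / ε)) := by
          rw [Finset.prod_mul_distrib, hP, Finset.prod_range, Finset.prod_const, Finset.card_univ,
            Fintype.card_fin]
      _ ≤ _ := by
          apply Finset.prod_le_prod
          · intro i _; have := hσpos i; positivity
          · intro i _
            have h1 : (((R i + 1 - -R i).toNat : ℕ) : ℝ) = 2 * (R i : ℝ) + 1 := by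
              have h2 : (((R i + 1 - -R i).toNat : ℕ) : ℤ) = 2 * R i + 1 := by
                have := hR0 i; omega
              exact_mod_cast h2
            rw [h1]
            have h3 : σ i * c / δ < R i + 1 := Int.lt_floor_add_one _
            have h4 : (0:ℝ) ≤ R i := by exact_mod_cast hR0 i
            have h5 : (N:ℝ) ^ (-a) / ε = c / δ := by
              rw [hc, hδ, ha, neg_add, Real.rpow_add hN0]
              field_simp
            rw [h5, ← mul_div_assoc]; linarith
  have hup : S.card ≤ n * 108 ^ N := by
    have hsub : S ⊆ (Finset.univ : Finset (Fin n)).biUnion (fun j => S.filter (fun m =>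
        ∑ i, (1:ℝ) * |(m i : ℝ) - y j i / δ| ≤ 2 * N)) := by
      intro m hm
      rw [Finset.mem_biUnion]
      have hm' : ∀ i, |(m i : ℝ)| ≤ σ i * c / δ := by
        intro i
        have := Finset.mem_Icc.1 ((Fintype.mem_piFinset.1 hm) i)
        have h1 : |m i| ≤ R i := abs_le.2 this
        have h2 : ((|m i| : ℤ) : ℝ) ≤ R i := by exact_mod_cast h1
        rw [Int.cast_abs] at h2
        exact h2.trans (Int.floor_le _)
      let x := mkv (fun i : Fin N => δ * m i / σ i) p
      have hx : ‖x‖ ≤ 1 := by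
        have := lemB p x N hN1 c hc0.le (fun i hi => by
          rw [mkv_lt _ _ i hi]
          have h1 := hm' ⟨i, hi⟩
          have h2 := hσpos i
          rw [abs_div, abs_mul, abs_of_pos hδ0, abs_of_pos h2, div_le_iff₀ h2]
          rw [le_div_iff₀ hδ0] at h1
          simp only at h1 ⊢
          linarith) (fun i hi => mkv_ge _ _ i hi)
        refine this.trans (le_of_eq ?_)
        rw [hc, ← Real.rpow_add hN0]; simp
      have hDx := hy ⟨x, by simpa using hx, rfl⟩
      obtain ⟨j, hj⟩ := Set.mem_iUnion.1 hDx
      refine ⟨j, Finset.mem_univ _, Finset.mem_filter.2 ⟨hm, ?_⟩⟩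
      rw [mem_closedBall, dist_eq_norm] at hj
      have h1 := lemA q (D x - y j) N hN1
      have h2 : ∀ i : Fin N, (1:ℝ) * |(m i : ℝ) - y j i / δ| = |(D x - y j) i| / δ := by
        intro i
        have : (D x - y j) i = D x i - y j i := rfl
        rw [this, hD, mkv_lt _ _ i i.2]
        have := hσpos i
        rw [one_mul, show σ i * (δ * m i / σ i) - y j i = δ * (m i - y j i / δ) by field_simp,
          abs_mul, abs_of_pos hδ0]
        field_simp
      simp_rw [h2]
      rw [← Finset.sum_div, div_le_iff₀ hδ0, ← Finset.sum_range (fun i => |(D x - y j) i|)]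
      calc _ ≤ _ := h1
        _ ≤ (N:ℝ) ^ (1 - (1 / q).toReal) * ε := by gcongr
        _ = N * δ := by rw [hδ, sub_eq_add_neg, Real.rpow_add hN0, Real.rpow_one]; ring
        _ ≤ _ := by nlinarith [mul_pos hN0 hδ0]
    refine (Finset.card_le_card hsub).trans ?_
    refine (Finset.card_biUnion_le_card_mul _ _ (108 ^ N) ?_).trans (by simp)
    intro j _
    have := countL (fun _ : Fin N => (1:ℝ)) (fun i => y j i / δ) (fun _ => one_pos)
      (fun _ => le_rfl) (S.filter (fun m =>
        ∑ i, (1:ℝ) * |(m i : ℝ) - y j i / δ| ≤ 2 * N)) (fun m hm => (Finset.mem_filter.1 hm).2)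
    simp only [div_one, Finset.prod_const, Finset.card_univ, Fintype.card_fin] at this
    exact_mod_cast this
  have hup' : (S.card : ℝ) ≤ n * 108 ^ N := by exact_mod_cast hup
  have h1 := hcard.trans hup'
  have hna : (N:ℝ) ^ a * (N:ℝ) ^ (-a) = 1 := by rw [← Real.rpow_add hN0]; simp
  have hNa : 0 < (N:ℝ) ^ a := by positivity
  have hNa' : 0 < (N:ℝ) ^ (-a) := by positivity
  have h2 : P / n ≤ (108 * ε * (N:ℝ) ^ a) ^ N := by
    rw [div_le_iff₀ hn0]
    have h3 : P = P * ((N:ℝ) ^ (-a) / ε) ^ N * (ε * (N:ℝ) ^ a) ^ N := by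
      rw [mul_assoc, ← mul_pow, show (N:ℝ) ^ (-a) / ε * (ε * (N:ℝ) ^ a) = 1 by
        field_simp; linarith]
      simp
    calc P = _ := h3
      _ ≤ (n * 108 ^ N) * (ε * (N:ℝ) ^ a) ^ N := by gcongr
      _ = _ := by rw [mul_pow, mul_pow, mul_pow]; ring
  have h4 : (P / n) ^ (1 / (N:ℝ)) ≤ 108 * ε * (N:ℝ) ^ a := by
    calc _ ≤ ((108 * ε * (N:ℝ) ^ a) ^ N) ^ (1 / (N:ℝ)) :=
          Real.rpow_le_rpow (by positivity) h2 (by positivity)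
      _ = _ := by
        rw [one_div, Real.pow_rpow_inv_natCast (by positivity) (by omega)]
  calc _ ≤ (N:ℝ) ^ (-a) * (108 * ε * (N:ℝ) ^ a) := by gcongr
    _ = 108 * ε * ((N:ℝ) ^ a * (N:ℝ) ^ (-a)) := by ring
    _ = _ := by rw [hna, mul_one]

lemma arithL (K k r L : ℕ) (hK : 1 ≤ K) (hk : 1 ≤ k) (hr : r = Nat.sqrt k) (hL : L = K * (r + 1)) :
    108 ^ (k + L) * (L * (k + 1)) ^ L ≤ (108 * 108 ^ (4 * K) * (8 * K) ^ (4 * K)) ^ k := by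
  have hr2 : r * r ≤ k := by rw [hr]; exact Nat.sqrt_le k
  have hr3 : k < (r + 1) * (r + 1) := by rw [hr]; exact Nat.lt_succ_sqrt k
  have hr1 : 1 ≤ r := by rw [hr]; exact Nat.sqrt_pos.2 hk
  have h4 : (r + 1) * (r + 1) ≤ 4 * k := by nlinarith
  have hL4 : L * (r + 1) ≤ 4 * K * k := by rw [hL]; nlinarith
  have hL5 : L ≤ 4 * K * k := by nlinarith
  have h2 : r + 1 ≤ 2 ^ (r + 1) := Nat.lt_two_pow_self.le
  have h6 : L * (k + 1) ≤ (8 * K) ^ (r + 1) := by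
    calc L * (k + 1) ≤ (K * (r + 1)) * ((r + 1) * (r + 1)) := by
          rw [hL]; exact Nat.mul_le_mul_left _ hr3
      _ ≤ (K ^ (r + 1) * 2 ^ (r + 1)) * (2 ^ (r + 1) * 2 ^ (r + 1)) := by
          gcongr
          exact Nat.le_self_pow (by omega) K
      _ = (8 * K) ^ (r + 1) := by
          rw [show 8 * K = K * 2 * (2 * 2) by ring, mul_pow, mul_pow, mul_pow]
  calc 108 ^ (k + L) * (L * (k + 1)) ^ L
      ≤ (108 ^ k * 108 ^ (4 * K * k)) * ((8 * K) ^ (r + 1)) ^ L := by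
        rw [pow_add]; gcongr; norm_num
    _ ≤ (108 ^ k * 108 ^ (4 * K * k)) * (8 * K) ^ (4 * K * k) := by
        rw [← pow_mul]
        apply Nat.mul_le_mul_left
        apply Nat.pow_le_pow_right (by omega)
        rw [mul_comm]; exact hL4
    _ = _ := by rw [pow_mul 108 (4 * K) k, pow_mul (8 * K) (4 * K) k, ← mul_pow, ← mul_pow]

lemma cover_of_finset {Y : Type*} [SeminormedAddCommGroup Y] {α : Type*} (S : Finset α) (n : ℕ)
    (h : S.card ≤ n) (ctr : α → Y) (ε : ℝ) (T : Set Y)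
    (hT : ∀ z ∈ T, ∃ m ∈ S, ‖z - ctr m‖ ≤ ε) :
    ∃ y : Fin n → Y, T ⊆ ⋃ i, Metric.closedBall (y i) ε := by
  refine ⟨fun j => if h : j.1 < S.card then ctr (S.equivFin.symm ⟨j, h⟩) else 0, ?_⟩
  intro z hz
  obtain ⟨m, hm, hzm⟩ := hT z hz
  refine Set.mem_iUnion.2 ⟨Fin.castLE h (S.equivFin ⟨m, hm⟩), ?_⟩
  rw [mem_closedBall, dist_eq_norm]
  simpa using hzm

lemma upperL (p q : ℝ≥0∞) [Fact (1 ≤ p)] [Fact (1 ≤ q)] (hpq : p < q) (a : ℝ) (ha0 : 0 ≤ a)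
    (ha : (1 / p).toReal = (1 / q).toReal + a)
    (σ : ℕ → ℝ) (hσpos : ∀ k, 0 < σ k) (hσanti : Antitone σ)
    (hσlim : Tendsto σ atTop (nhds 0))
    (K : ℕ) (hK : 1 ≤ K) (b C : ℝ) (hC : 1 ≤ C) (hb : 1 < b) (hKb : 4 * C ≤ b ^ K)
    (hexp : ∀ k L : ℕ, σ (k + L) * b ^ L ≤ C * σ k)
    (D : lp (fun _ : ℕ => ℝ) p →L[ℝ] lp (fun _ : ℕ => ℝ) q)
    (hD : ∀ (x : lp (fun _ : ℕ => ℝ) p) (k : ℕ), D x k = σ k * x k)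
    (n : ℕ) (hn : 1 ≤ n) (ε : ℝ) (hε : 0 < ε)
    (hM : ∀ k : ℕ, 1 ≤ k → ((108 * 108 ^ (4 * K) * (8 * K) ^ (4 * K) : ℕ) : ℝ) ^ k *
      (∏ i ∈ Finset.range k, σ i) ≤ n * (ε * (k:ℝ) ^ a) ^ k) :
    ∃ y : Fin n → lp (fun _ : ℕ => ℝ) q,
      D '' Metric.closedBall 0 1 ⊆ ⋃ i, Metric.closedBall (y i) (3 * ε) := by
  classical
  have hp1 : 1 ≤ p := Fact.out
  have hpr1 : (1 / p).toReal ≤ 1 := by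
    rw [← ENNReal.toReal_one]
    apply ENNReal.toReal_mono ENNReal.one_ne_top
    rw [one_div]; exact ENNReal.inv_le_one.2 hp1
  have ha1 : a ≤ 1 := by
    have : 0 ≤ (1 / q).toReal := ENNReal.toReal_nonneg
    linarith
  have hex : ∃ k : ℕ, σ k < ε * ((k + 1 : ℕ) : ℝ) ^ a := by
    obtain ⟨k, hk⟩ := ((tendsto_order.1 hσlim).2 ε hε).exists
    refine ⟨k, hk.trans_le ?_⟩
    have : 1 ≤ ((k + 1 : ℕ) : ℝ) ^ a := Real.one_le_rpow (by simp) ha0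
    nlinarith
  set k := Nat.find hex with hkdef
  have hk1 : σ k < ε * ((k + 1 : ℕ) : ℝ) ^ a := Nat.find_spec hex
  have hk2 : ∀ i < k, ε * ((i + 1 : ℕ) : ℝ) ^ a ≤ σ i := fun i hi => not_lt.1 (Nat.find_min hex hi)
  clear_value k
  rcases Nat.eq_zero_or_pos k with h0 | hkpos
  · subst h0
    refine ⟨fun _ => 0, ?_⟩
    rintro _ ⟨x, hx, rfl⟩
    refine Set.mem_iUnion.2 ⟨⟨0, hn⟩, ?_⟩
    have hx' : ‖x‖ ≤ 1 := by simpa using hx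
    rw [mem_closedBall, dist_zero_right]
    refine lemE p q hpq x hx' (D x) 0 0 ε hε (by simp) (by intro i h h'; omega) ?_
    intro i _
    rw [hD, abs_mul, abs_of_pos (hσpos i)]
    have h1 := hσanti (Nat.zero_le i)
    simp at hk1
    gcongr
    linarith
  · have hkr : (0:ℝ) < k := by exact_mod_cast hkpos
    obtain ⟨r, hr⟩ : ∃ r, r = Nat.sqrt k := ⟨_, rfl⟩
    obtain ⟨L, hL⟩ : ∃ L, L = K * (r + 1) := ⟨_, rfl⟩
    have har := arithL K k r L hK hkpos hr hL
    have hLpos : 1 ≤ L := by rw [hL]; nlinarith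
    have hLr : (1:ℝ) ≤ L := by exact_mod_cast hLpos
    have hka : 0 < (k:ℝ) ^ a := by positivity
    have hkp1 : ((k + 1 : ℕ) : ℝ) ^ a ≤ k + 1 := by
      have := Real.rpow_le_rpow_of_exponent_le (x := ((k + 1 : ℕ) : ℝ)) (by simp) ha1
      simpa using this
    have hσk : σ k ≤ ε * (k + 1) := hk1.le.trans (by gcongr)
    have hhead : ∀ i < k, ε * (k:ℝ) ^ a ≤ σ i := by
      intro i hi
      have h1 := hk2 (k - 1) (by omega)
      rw [Nat.sub_add_cancel hkpos] at h1
      exact h1.trans (hσanti (by omega))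
    have htail : σ (k + L) ≤ ε := by
      have h1 := hexp k L
      have hr3 : k < (r + 1) * (r + 1) := by rw [hr]; exact Nat.lt_succ_sqrt k
      have h2 : C * (k + 1) ≤ b ^ L := by
        calc C * ((k:ℝ) + 1) ≤ C ^ (r + 1) * (2 ^ (r + 1) * 2 ^ (r + 1)) := by
              have e1 : C ≤ C ^ (r + 1) := le_self_pow₀ hC (by omega)
              have e2 : ((k:ℝ) + 1) ≤ 2 ^ (r + 1) * 2 ^ (r + 1) := by
                have h2 : r + 1 ≤ 2 ^ (r + 1) := Nat.lt_two_pow_self.le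
                have : k + 1 ≤ 2 ^ (r + 1) * 2 ^ (r + 1) := by
                  refine le_trans hr3 (Nat.mul_le_mul h2 h2)
                exact_mod_cast this
              gcongr
          _ = (4 * C) ^ (r + 1) := by
              rw [← mul_pow, ← mul_pow]; congr 1; ring
          _ ≤ (b ^ K) ^ (r + 1) := by gcongr
          _ = b ^ L := by rw [hL, pow_mul]
      have h3 : 0 < b ^ L := by positivity
      have h4 : σ (k + L) * b ^ L ≤ ε * b ^ L := by
        calc _ ≤ C * σ k := h1
          _ ≤ C * (ε * (k + 1)) := by gcongr
          _ = ε * (C * (k + 1)) := by ring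
          _ ≤ _ := by gcongr
      exact le_of_mul_le_mul_right h4 h3
    let T : ℕ → ℝ := fun i => if i < k then ε * (k:ℝ) ^ a / σ i else 1 / (L * (k + 1))
    let δ : ℕ → ℝ := fun i => if i < k then ε * (k:ℝ) ^ (-(1 / q).toReal) else ε / L
    have hT0 : ∀ i, 0 < T i := by
      intro i; have := hσpos i; simp only [T]; split_ifs <;> positivity
    have hT1 : ∀ i, T i ≤ 1 := by
      intro i; simp only [T]; split_ifs with h
      · rw [div_le_one (hσpos i)]; exact hhead i h
      · rw [div_le_one (by positivity)]; nlinarith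
    have hδ0 : ∀ i, 0 < δ i := by
      intro i; simp only [δ]; split_ifs <;> positivity
    let S : Finset (Fin (k + L) → ℤ) := (Fintype.piFinset (fun i : Fin (k + L) =>
      Finset.Icc (-⌈2 * ((k + L : ℕ):ℝ) / T i⌉) ⌈2 * ((k + L : ℕ):ℝ) / T i⌉)).filter
        (fun m => ∑ i : Fin (k + L), T i * |(m i : ℝ) - 0| ≤ 2 * ((k + L : ℕ):ℝ))
    have hScard : S.card ≤ n := by
      have h1 := countL (fun i : Fin (k + L) => T i) (fun _ => 0) (fun i => hT0 i)
        (fun i => hT1 i) S (fun m hm => (Finset.mem_filter.1 hm).2)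
      rw [← Finset.prod_range (fun i => 108 / T i), Finset.prod_range_add] at h1
      have e1 : ∏ x ∈ Finset.range k, 108 / T x =
          108 ^ k * (∏ i ∈ Finset.range k, σ i) / (ε * (k:ℝ) ^ a) ^ k := by
        have : ∏ x ∈ Finset.range k, 108 / T x =
            ∏ x ∈ Finset.range k, (108 / (ε * (k:ℝ) ^ a)) * σ x := by
          apply Finset.prod_congr rfl
          intro i hi
          simp only [T, if_pos (Finset.mem_range.1 hi)]
          have := hσpos i
          field_simp
        rw [this, Finset.prod_mul_distrib]
        simp only [Finset.prod_const, Finset.card_range, div_pow]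
        ring
      have e2 : ∏ x ∈ Finset.range L, 108 / T (k + x) = 108 ^ L * ((L:ℝ) * (k + 1)) ^ L := by
        have : ∏ x ∈ Finset.range L, 108 / T (k + x) =
            ∏ x ∈ Finset.range L, 108 * ((L:ℝ) * (k + 1)) := by
          apply Finset.prod_congr rfl
          intro i hi
          simp only [T, if_neg (by omega : ¬ k + i < k)]
          field_simp
        rw [this]
        simp only [Finset.prod_const, Finset.card_range, mul_pow]
      rw [e1, e2] at h1
      have h2 := hM k hkpos
      have har' : (108:ℝ) ^ (k + L) * ((L:ℝ) * (k + 1)) ^ L ≤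
          ((108 * 108 ^ (4 * K) * (8 * K) ^ (4 * K) : ℕ) : ℝ) ^ k := by exact_mod_cast har
      set P := ∏ i ∈ Finset.range k, σ i with hP
      have hP0 : 0 < P := Finset.prod_pos fun i _ => hσpos i
      set W := (ε * (k:ℝ) ^ a) ^ k with hW
      have hW0 : 0 < W := by positivity
      have h3 : (S.card : ℝ) ≤ n := by
        calc (S.card : ℝ) ≤ _ := h1
          _ = ((108:ℝ) ^ (k + L) * ((L:ℝ) * (k + 1)) ^ L) * P / W := by rw [pow_add]; ring
          _ ≤ ((108 * 108 ^ (4 * K) * (8 * K) ^ (4 * K) : ℕ) : ℝ) ^ k * P / W := by gcongr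
          _ ≤ n := by rw [div_le_iff₀ hW0]; exact h2
      exact_mod_cast h3
    apply cover_of_finset S n hScard (fun m => mkv (fun i => δ i * (m i : ℝ)) q)
    rintro _ ⟨x, hx, rfl⟩
    have hx' : ‖x‖ ≤ 1 := by simpa using hx
    have hxi : ∀ i, |x i| ≤ 1 := fun i =>
      (lp.norm_apply_le_norm (by rintro rfl; simp at hp1) x i).trans hx'
    let m : Fin (k + L) → ℤ := fun i => ⌊σ i * x i / δ i⌋
    have hfl : ∀ i : Fin (k + L), |σ i * x i / δ i - m i| ≤ 1 := by
      intro i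
      have h1 := Int.floor_le (σ i * x i / δ i)
      have h2 := Int.lt_floor_add_one (σ i * x i / δ i)
      simp only [m]
      rw [abs_le]; constructor <;> linarith
    have hsum : ∑ i : Fin (k + L), T i * |(m i : ℝ) - 0| ≤ 2 * ((k + L : ℕ):ℝ) := by
      have s1 : ∀ i : Fin (k + L), T i * |(m i : ℝ) - 0| ≤ T i * |σ i * x i / δ i| + 1 := by
        intro i
        have h1 := hfl i
        have h2 : |(m i : ℝ)| ≤ |σ i * x i / δ i| + 1 := by
          have := abs_sub_abs_le_abs_sub (m i : ℝ) (σ i * x i / δ i)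
          rw [abs_sub_comm] at this
          linarith
        rw [sub_zero]
        have := hT0 i
        have := hT1 i
        nlinarith
      refine (Finset.sum_le_sum fun i _ => s1 i).trans ?_
      rw [Finset.sum_add_distrib, ← Finset.sum_range (fun i => T i * |σ i * x i / δ i|),
        Finset.sum_range_add]
      have e1 : ∑ i ∈ Finset.range k, T i * |σ i * x i / δ i| ≤ k := by
        have : ∑ i ∈ Finset.range k, T i * |σ i * x i / δ i| =
            (k:ℝ) ^ (1 / p).toReal * ∑ i ∈ Finset.range k, |x i| := by
          rw [Finset.mul_sum]
          apply Finset.sum_congr rfl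
          intro i hi
          simp only [T, δ, if_pos (Finset.mem_range.1 hi)]
          have := hσpos i
          rw [abs_div, abs_mul, abs_of_pos this,
            abs_of_pos (by positivity : 0 < ε * (k:ℝ) ^ (-(1 / q).toReal)), ha,
            Real.rpow_add hkr, Real.rpow_neg hkr.le]
          field_simp
        rw [this]
        calc _ ≤ (k:ℝ) ^ (1 / p).toReal * ((k:ℝ) ^ (1 - (1 / p).toReal) * 1) := by
              gcongr
              exact (lemA p x k hkpos).trans (by gcongr)
          _ = k := by rw [mul_one, ← Real.rpow_add hkr]; simp
      have e2 : ∑ i ∈ Finset.range L, T (k + i) * |σ (k + i) * x (k + i) / δ (k + i)| ≤ L := by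
        calc _ ≤ ∑ i ∈ Finset.range L, (1:ℝ) := by
              apply Finset.sum_le_sum
              intro i _
              have h1 := hσpos (k + i)
              have h2 : σ (k + i) ≤ ε * (k + 1) := (hσanti (Nat.le_add_right k i)).trans hσk
              simp only [T, δ, if_neg (by omega : ¬ k + i < k)]
              rw [abs_div, abs_mul, abs_of_pos h1, abs_of_pos (by positivity : 0 < ε / (L:ℝ))]
              rw [show 1 / ((L:ℝ) * (k + 1)) * (σ (k + i) * |x (k + i)| / (ε / L))
                = σ (k + i) * |x (k + i)| / (ε * (k + 1)) by field_simp]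
              rw [div_le_one (by positivity)]
              have := hxi (k + i)
              nlinarith
          _ = L := by simp
      simp only [Finset.sum_const, Finset.card_univ, Fintype.card_fin, nsmul_eq_mul, mul_one]
      push_cast
      linarith
    refine ⟨m, Finset.mem_filter.2 ⟨?_, hsum⟩, ?_⟩
    · rw [Fintype.mem_piFinset]
      intro i
      have h1 : T i * |(m i : ℝ) - 0| ≤ 2 * ((k + L : ℕ):ℝ) :=
        (Finset.single_le_sum (f := fun i : Fin (k + L) => T i * |(m i : ℝ) - 0|)
          (fun j _ => mul_nonneg (hT0 j).le (abs_nonneg _)) (Finset.mem_univ i)).trans hsum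
      rw [sub_zero, ← le_div_iff₀' (hT0 i)] at h1
      have h2 := h1.trans (Int.le_ceil _)
      rw [← Int.cast_abs] at h2
      have h3 : |m i| ≤ ⌈2 * ((k + L : ℕ):ℝ) / T i⌉ := by exact_mod_cast h2
      exact Finset.mem_Icc.2 (abs_le.1 h3)
    · set z := D x - mkv (fun i => δ i * (m i : ℝ)) q with hz
      have hzi : ∀ i, z i = σ i * x i - mkv (fun i => δ i * (m i : ℝ)) q i := by
        intro i
        rw [← hD]; rfl
      have hz1 : ∀ i, i < k + L → |z i| ≤ δ i := by
        intro i hi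
        rw [hzi, mkv_lt _ _ i hi]
        have h1 := hfl ⟨i, hi⟩
        simp only at h1 ⊢
        have h2 := hδ0 i
        rw [show σ i * x i - δ i * (m ⟨i, hi⟩ : ℝ) = δ i * (σ i * x i / δ i - m ⟨i, hi⟩) by
          field_simp, abs_mul, abs_of_pos h2]
        nlinarith
      refine lemE p q hpq x hx' z k L ε hε ?_ ?_ ?_
      · intro i hi
        have := hz1 i (by omega)
        simpa only [δ, if_pos hi] using this
      · intro i hi hi'
        have := hz1 i hi'
        simpa only [δ, if_neg (not_lt.2 hi)] using this
      · intro i hi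
        rw [hzi, mkv_ge _ _ i hi, sub_zero, abs_mul, abs_of_pos (hσpos i)]
        gcongr
        exact (hσanti hi).trans htail

/-- **Theorem 1 (optimality for `p < q` under (EXP)).**
Let `1 ≤ p < q ≤ ∞` with `1/p = 1/q + 1/s`, and let `σ` be a non-increasing sequence of
positive reals tending to zero (here `σ k` denotes the `(k+1)`-st term `σ_{k+1}` of the
paper).  Assume (EXP): there is `b > 1` with `sup_{k ≤ n} σ_n b^n / (σ_k b^k) < ∞`.
Then the entropy numbers of the diagonal operator `D_σ : ℓ_p → ℓ_q` satisfy
`e_n(D_σ) ≍ sup_{k ≥ 1} k^{-1/s} (σ_1⋯σ_k / n)^{1/k}`. -/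
theorem statement1 (p q s : ℝ≥0∞) [Fact (1 ≤ p)] [Fact (1 ≤ q)]
    (hpq : p < q) (hs : 1 / p = 1 / q + 1 / s)
    (σ : ℕ → ℝ) (hσpos : ∀ k, 0 < σ k) (hσanti : Antitone σ)
    (hσlim : Tendsto σ atTop (nhds 0))
    (hEXP : ∃ b : ℝ, 1 < b ∧ ∃ C : ℝ, ∀ k n : ℕ, k ≤ n →
        σ n * b ^ n / (σ k * b ^ k) ≤ C)
    (D : lp (fun _ : ℕ => ℝ) p →L[ℝ] lp (fun _ : ℕ => ℝ) q)
    (hD : ∀ (x : lp (fun _ : ℕ => ℝ) p) (k : ℕ), D x k = σ k * x k) :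
    ∃ c₁ c₂ : ℝ, 0 < c₁ ∧ 0 < c₂ ∧ ∀ n : ℕ, 1 ≤ n →
      c₁ * (⨆ k : ℕ, (k + 1 : ℝ) ^ (-(1 / s).toReal) *
          ((∏ i ∈ Finset.range (k + 1), σ i) / n) ^ (1 / (k + 1 : ℝ))) ≤
        entropyNumber n (D '' Metric.closedBall 0 1) ∧
      entropyNumber n (D '' Metric.closedBall 0 1) ≤
        c₂ * ⨆ k : ℕ, (k + 1 : ℝ) ^ (-(1 / s).toReal) *
          ((∏ i ∈ Finset.range (k + 1), σ i) / n) ^ (1 / (k + 1 : ℝ)) := by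
  classical
  obtain ⟨b, hb, C₀, hC₀⟩ := hEXP
  have hp1 : 1 ≤ p := Fact.out
  have hq1 : 1 ≤ q := Fact.out
  set a := (1 / s).toReal with hadef
  have ha0 : 0 ≤ a := ENNReal.toReal_nonneg
  have hpfin : 1 / p ≠ ∞ := by
    rw [one_div]; exact ((ENNReal.inv_le_one.2 hp1).trans_lt ENNReal.one_lt_top).ne
  have ha : (1 / p).toReal = (1 / q).toReal + a := by
    rw [hs, ENNReal.toReal_add]
    · intro h; rw [h] at hs; simp at hs; rw [hs] at hp1; simp at hp1
    · intro h; rw [h] at hs; simp at hs; rw [hs] at hp1; simp at hp1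
  set C := max C₀ 1 with hCdef
  have hC1 : 1 ≤ C := le_max_right _ _
  have hexp : ∀ k L : ℕ, σ (k + L) * b ^ L ≤ C * σ k := by
    intro k L
    have h1 := hC₀ k (k + L) (Nat.le_add_right _ _)
    have h2 := hσpos k
    have h3 : 0 < b ^ k := by positivity
    rw [div_le_iff₀ (by positivity), pow_add] at h1
    have h4 : C₀ * (σ k * b ^ k) ≤ C * (σ k * b ^ k) := by gcongr; exact le_max_left _ _
    have h5 : (σ (k + L) * b ^ L) * b ^ k ≤ (C * σ k) * b ^ k := by nlinarith
    exact le_of_mul_le_mul_right h5 h3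
  obtain ⟨K, hK1, hKb⟩ : ∃ K : ℕ, 1 ≤ K ∧ 4 * C ≤ b ^ K := by
    obtain ⟨K, hK⟩ := pow_unbounded_of_one_lt (4 * C) hb
    exact ⟨K + 1, by omega, hK.le.trans (pow_le_pow_right₀ hb.le (by omega))⟩
  obtain ⟨B, hB⟩ : ∃ B : ℕ, B = 108 * 108 ^ (4 * K) * (8 * K) ^ (4 * K) := ⟨_, rfl⟩
  have hB0 : (0:ℝ) < B := by
    have : 0 < B := by rw [hB]; positivity
    exact_mod_cast this
  refine ⟨1 / 108, 3 * B, by norm_num, by positivity, ?_⟩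
  intro n hn
  have hn0 : (0:ℝ) < n := by exact_mod_cast hn
  set f : ℕ → ℝ := fun k => (k + 1 : ℝ) ^ (-a) *
          ((∏ i ∈ Finset.range (k + 1), σ i) / n) ^ (1 / (k + 1 : ℝ)) with hf
  have hlow : ∀ ε ∈ {ε : ℝ | 0 < ε ∧ ∃ y : Fin n → lp (fun _ : ℕ => ℝ) q,
      D '' Metric.closedBall 0 1 ⊆ ⋃ i, Metric.closedBall (y i) ε}, ∀ k, f k ≤ 108 * ε := by
    rintro ε ⟨hε, y, hy⟩ k
    exact lowerL p q a ha σ hσpos D hD n hn ε hε y hy k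
  have hne : (‖D‖ + 1) ∈ {ε : ℝ | 0 < ε ∧ ∃ y : Fin n → lp (fun _ : ℕ => ℝ) q,
      D '' Metric.closedBall 0 1 ⊆ ⋃ i, Metric.closedBall (y i) ε} := by
    refine ⟨by positivity, fun _ => 0, ?_⟩
    rintro _ ⟨x, hx, rfl⟩
    refine Set.mem_iUnion.2 ⟨⟨0, hn⟩, ?_⟩
    have hx' : ‖x‖ ≤ 1 := by simpa using hx
    rw [mem_closedBall, dist_zero_right]
    have h1 := D.le_opNorm x
    have h2 := norm_nonneg D
    nlinarith
  have hbdd : BddAbove (Set.range f) := by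
    refine ⟨108 * (‖D‖ + 1), ?_⟩
    rintro _ ⟨k, rfl⟩
    exact hlow _ hne k
  constructor
  · apply le_csInf ⟨_, hne⟩
    intro ε hε
    have : (⨆ k, f k) ≤ 108 * ε := ciSup_le (hlow ε hε)
    linarith
  · set M := ⨆ k, f k with hM
    have hM0 : 0 < M := by
      have h1 : f 0 ≤ M := le_ciSup hbdd 0
      have h2 : 0 < f 0 := by
        simp only [hf]
        have : 0 < ∏ i ∈ Finset.range (0 + 1), σ i := Finset.prod_pos fun i _ => hσpos i
        positivity
      linarith
    have hup := upperL p q hpq a ha0 ha σ hσpos hσanti hσlim K hK1 b C hC1 hb hKb hexp D hD n hn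
      (B * M) (by positivity) (by
        intro k hk
        rw [← hB]
        obtain ⟨j, rfl⟩ : ∃ j, k = j + 1 := ⟨k - 1, by omega⟩
        have h1 : f j ≤ M := le_ciSup hbdd j
        simp only [hf] at h1
        have hj : ((j + 1 : ℕ) : ℝ) = (j:ℝ) + 1 := by push_cast; rfl
        rw [← hj] at h1
        have hj0 : (0:ℝ) < ((j + 1 : ℕ) : ℝ) := by positivity
        set P := ∏ i ∈ Finset.range (j + 1), σ i with hP
        have hP0 : 0 < P := Finset.prod_pos fun i _ => hσpos i
        set J := ((j + 1 : ℕ) : ℝ) with hJ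
        have hJa : 0 < J ^ a := by positivity
        have h2 : (P / n) ^ (1 / J) ≤ M * J ^ a := by
          rw [Real.rpow_neg hj0.le, inv_mul_le_iff₀ hJa] at h1
          linarith
        have h3 : P / n ≤ (M * J ^ a) ^ (j + 1) := by
          calc P / n = ((P / n) ^ (1 / J)) ^ (j + 1) := by
                rw [one_div, hJ, Real.rpow_inv_natCast_pow (by positivity) (by omega)]
            _ ≤ _ := by gcongr
        rw [div_le_iff₀ hn0] at h3
        calc (B:ℝ) ^ (j + 1) * P ≤ (B:ℝ) ^ (j + 1) * ((M * J ^ a) ^ (j + 1) * n) := by gcongr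
          _ = _ := by rw [mul_pow, mul_pow, mul_pow]; ring)
    refine csInf_le ⟨0, fun ε hε => hε.1.le⟩ ⟨by positivity, ?_⟩
    obtain ⟨y, hy⟩ := hup
    refine ⟨y, ?_⟩
    rw [mul_assoc]; exact hy
end

section
/- Let 1 ≤ q < p ≤ ∞ with 1/q = 1/p + 1/r, and let σ = (σ_k)_{k≥1} be a non-increasing sequence of positive real numbers with σ_k → 0 and ∑_{k≥1} σ_k^r < ∞. Define the tail sequence τ_k = (∑_{n≥k} σ_n^r)^{1/r}. Then there exists a constant C > 0 such that for all n ≥ 1 the n-th entropy number of the diagonal operator D_σ : ℓ_p → ℓ_q satisfies e_n(D_σ) ≤ C · sup_{k≥1} ( (τ_k + k^{1/r} σ_1)·(τ_k + k^{1/r} σ_2)·…·(τ_k + k^{1/r} σ_k) / n )^{1/k}. -/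
open Metric Filter
open scoped ENNReal

/-- The tail sequence `τ_{k+1} = (∑_{n ≥ k} σ_n^r)^{1/r}` of a (0-indexed) sequence `σ`. -/
noncomputable def tailSeq (r : ℝ) (σ : ℕ → ℝ) (k : ℕ) : ℝ :=
  (∑' j : ℕ, if k ≤ j then σ j ^ r else 0) ^ (1 / r)

open MeasureTheory in
theorem cov_aux {F : Type*} [NormedAddCommGroup F] [NormedSpace ℝ F] [FiniteDimensional ℝ F]
    (A : Set F) (S : F →ₗ[ℝ] F) (δ : ℝ) (hδ : 0 < δ) (n : ℕ) (hn : 1 ≤ n)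
    (hA : ∀ x ∈ A, Metric.closedBall x (δ/2) ⊆ S '' Metric.closedBall 0 1)
    (hdet : |LinearMap.det S| ≤ (δ/2) ^ (Module.finrank ℝ F) * n) :
    ∃ y : Fin n → F, A ⊆ ⋃ i, Metric.closedBall (y i) δ := by
  borelize F
  let μ : Measure F := Measure.addHaar
  set V := μ (closedBall (0:F) 1) with hV
  have hV0 : V ≠ 0 := (measure_closedBall_pos μ 0 one_pos).ne'
  have hVt : V ≠ ⊤ := measure_closedBall_lt_top.ne
  let e : NNReal := ⟨δ, hδ.le⟩
  have key : ∀ T : Finset F, (T : Set F) ⊆ A → IsSeparated e (T : Set F) → T.card ≤ n := by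
    intro T hTA hTs
    have hdisj : (T : Set F).PairwiseDisjoint (fun x => closedBall x (δ/2)) := by
      intro x hx y hy hxy
      apply Metric.closedBall_disjoint_closedBall
      have : (e : ENNReal) < edist x y := hTs hx hy hxy
      rw [edist_dist, show ((e : NNReal) : ENNReal) = ENNReal.ofReal δ from
        (ENNReal.ofReal_eq_coe_nnreal hδ.le).symm] at this
      have := (ENNReal.ofReal_lt_ofReal_iff_of_nonneg hδ.le).1 this
      linarith
    have h1 : μ (⋃ x ∈ T, closedBall x (δ/2)) = ∑ x ∈ T, μ (closedBall x (δ/2)) :=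
      measure_biUnion_finset hdisj (fun x _ => measurableSet_closedBall)
    have h2 : μ (⋃ x ∈ T, closedBall x (δ/2)) ≤ μ (S '' closedBall 0 1) :=
      measure_mono (Set.iUnion₂_subset fun x hx => hA x (hTA hx))
    rw [h1, Measure.addHaar_image_linearMap] at h2
    simp_rw [Measure.addHaar_closedBall' μ _ (by positivity : (0:ℝ) ≤ δ/2)] at h2
    rw [Finset.sum_const, nsmul_eq_mul, ← mul_assoc, ENNReal.mul_le_mul_iff_left hV0 hVt,
      ← ENNReal.ofReal_natCast, ← ENNReal.ofReal_mul (by positivity),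
      ENNReal.ofReal_le_ofReal_iff (by positivity)] at h2
    have h3 := h2.trans hdet
    have h4 : (0:ℝ) < (δ/2) ^ (Module.finrank ℝ F) := by positivity
    rw [mul_comm] at h3
    exact_mod_cast le_of_mul_le_mul_left h3 h4
  have hp : packingNumber e A ≤ n := by
    refine iSup_le fun C => iSup_le fun hC => iSup_le fun hs => ?_
    by_contra hcon
    push Not at hcon
    have : ((n+1 : ℕ) : ℕ∞) ≤ C.encard := by
      push_cast; exact Order.add_one_le_of_lt hcon
    obtain ⟨t, htC, htc⟩ := Set.exists_subset_encard_eq this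
    have hfin : t.Finite := Set.finite_of_encard_eq_coe htc
    have := key hfin.toFinset (by simpa using htC.trans hC) (by simpa using hs.subset htC)
    have h5 := hfin.encard_eq_coe_toFinset_card
    rw [htc] at h5
    have : n + 1 = hfin.toFinset.card := by exact_mod_cast h5
    omega
  have hpt : packingNumber e A ≠ ⊤ := ne_top_of_le_ne_top (by simp) hp
  set M := maximalSeparatedSet e A
  have hMc : M.encard ≤ n := (encard_maximalSeparatedSet hpt).le.trans hp
  have hcov := isCover_maximalSeparatedSet hpt
  have hMfin : M.Finite := Set.finite_of_encard_le_coe hMc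
  have hcard : hMfin.toFinset.card ≤ n := by
    rw [hMfin.encard_eq_coe_toFinset_card] at hMc
    exact_mod_cast hMc
  by_cases hMe : M.Nonempty
  · have : Nonempty (Fin n) := ⟨⟨0, hn⟩⟩
    have hne : Nonempty M := hMe.to_subtype
    have : Finite M := hMfin
    have : Fintype M := Fintype.ofFinite _
    have hc : Fintype.card M ≤ Fintype.card (Fin n) := by
      rw [Fintype.card_fin, ← Set.toFinset_card]
      convert hcard using 2
      ext; simp
    obtain ⟨f⟩ := Function.Embedding.nonempty_of_card_le hc
    refine ⟨fun i => (Function.invFun f i : M), fun x hx => ?_⟩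
    obtain ⟨z, hz, hxz⟩ := hcov hx
    rw [Set.mem_iUnion]
    refine ⟨f ⟨z, hz⟩, ?_⟩
    beta_reduce
    rw [Function.leftInverse_invFun f.injective ⟨z, hz⟩]
    change edist x z ≤ e at hxz
    rw [mem_closedBall]
    rw [edist_nndist, ENNReal.coe_le_coe] at hxz
    exact hxz
  · refine ⟨fun _ => 0, fun x hx => ?_⟩
    obtain ⟨z, hz, hxz⟩ := hcov hx
    exact absurd ⟨z, hz⟩ hMe

theorem holder_aux (p q r : ℝ≥0∞) [Fact (1 ≤ p)] [Fact (1 ≤ q)] [Fact (1 ≤ r)]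
    (hr : 1 / q = 1 / p + 1 / r) (hr0 : 0 < r.toReal)
    (a : ℕ → ℝ) (ha : ∀ k, 0 ≤ a k) (has : Summable fun k => a k ^ r.toReal)
    (u : lp (fun _ : ℕ => ℝ) p) (z : lp (fun _ : ℕ => ℝ) q)
    (hz : ∀ k, |z k| ≤ a k * |u k|) :
    ‖z‖ ≤ (∑' k, a k ^ r.toReal) ^ (1 / r.toReal) * ‖u‖ := by
  have : ENNReal.HolderTriple r p q := ⟨by
    simp only [one_div] at hr; rw [hr, add_comm]⟩
  let A : lp (fun _ : ℕ => ℝ) r := ⟨a, memℓp_gen (by simpa [abs_of_nonneg, ha] using has)⟩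
  have hA : ‖A‖ = (∑' k, a k ^ r.toReal) ^ (1 / r.toReal) := by
    rw [lp.norm_eq_tsum_rpow hr0]
    simp [A, abs_of_nonneg, ha]
  rw [← hA]
  have hB : ∀ _ : ℕ, ‖ContinuousLinearMap.mul ℝ ℝ‖ ≤ ((1 : NNReal) : ℝ) := fun _ => by simp
  let w := lp.holderL q (fun _ : ℕ => ContinuousLinearMap.mul ℝ ℝ) hB A u
  have hw : ‖w‖ ≤ ‖A‖ * ‖u‖ := by
    have h1 : ‖lp.holderL (p := r) (q := p) q (fun _ : ℕ => ContinuousLinearMap.mul ℝ ℝ) hB‖ ≤ 1 :=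
      LinearMap.mkContinuous₂_norm_le _ (by simp) _
    calc ‖w‖ ≤ _ := ContinuousLinearMap.le_opNorm₂ _ _ _
      _ ≤ 1 * ‖A‖ * ‖u‖ := by gcongr
      _ = _ := by ring
  refine le_trans (lp.norm_mono (zero_lt_one.trans_le (Fact.out : 1 ≤ q)).ne' ?_) hw
  intro i
  have : w i = a i * u i := rfl
  rw [this]
  simpa [abs_mul, abs_of_nonneg (ha i)] using hz i

def headSub (p : ℝ≥0∞) [Fact (1 ≤ p)] (m : ℕ) : Submodule ℝ (lp (fun _ : ℕ => ℝ) p) where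
  carrier := {x | ∀ k, m ≤ k → x k = 0}
  add_mem' := by
    intro a b ha hb k hk
    simp [ha k hk, hb k hk]
  zero_mem' := by intro k hk; simp
  smul_mem' := by
    intro c x hx k hk
    simp [hx k hk]

def headMk (p : ℝ≥0∞) [Fact (1 ≤ p)] (m : ℕ) (f : ℕ → ℝ) : headSub p m :=
  ⟨⟨fun k => if k < m then f k else 0, by
    refine (memℓp_zero ?_).of_exponent_ge (zero_le)
    refine (Set.finite_lt_nat m).subset ?_
    intro k hk
    by_contra h
    simp only [Set.mem_ofPred_eq] at h hk
    simp [h] at hk⟩, by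
    intro k hk
    simp [not_lt.2 hk]⟩

theorem headMk_apply (p : ℝ≥0∞) [Fact (1 ≤ p)] (m : ℕ) (f : ℕ → ℝ) (k : ℕ) :
    (headMk p m f : lp (fun _ : ℕ => ℝ) p) k = if k < m then f k else 0 := rfl

theorem head_ext (p : ℝ≥0∞) [Fact (1 ≤ p)] (m : ℕ) (x y : headSub p m)
    (h : ∀ k, k < m → (x : lp (fun _ : ℕ => ℝ) p) k = (y : lp (fun _ : ℕ => ℝ) p) k) : x = y := by
  apply Subtype.ext
  apply lp.ext
  funext k
  by_cases hk : k < m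
  · exact h k hk
  · rw [x.2 k (not_lt.1 hk), y.2 k (not_lt.1 hk)]

noncomputable def headEquiv (p : ℝ≥0∞) [Fact (1 ≤ p)] (m : ℕ) :
    headSub p m ≃ₗ[ℝ] (Fin m → ℝ) where
  toFun x := fun i => (x : lp (fun _ : ℕ => ℝ) p) i
  map_add' := by intro x y; ext i; simp
  map_smul' := by intro c x; ext i; simp
  invFun v := headMk p m (fun k => if h : k < m then v ⟨k, h⟩ else 0)
  left_inv := by
    intro x
    apply head_ext
    intro k hk
    rw [headMk_apply]
    simp [hk]
  right_inv := by
    intro v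
    ext i
    change (if (i:ℕ) < m then (if h : (i:ℕ) < m then v ⟨i, h⟩ else 0) else 0) = v i
    simp

noncomputable def headDiag (p : ℝ≥0∞) [Fact (1 ≤ p)] (m : ℕ) (d : ℕ → ℝ) :
    headSub p m →ₗ[ℝ] headSub p m where
  toFun x := headMk p m (fun k => d k * (x : lp (fun _ : ℕ => ℝ) p) k)
  map_add' := by
    intro x y
    apply head_ext
    intro k hk
    simp [headMk_apply, hk, mul_add]
  map_smul' := by
    intro c x
    apply head_ext
    intro k hk
    simp [headMk_apply, hk]
    ring

theorem headDiag_apply (p : ℝ≥0∞) [Fact (1 ≤ p)] (m : ℕ) (d : ℕ → ℝ) (x : headSub p m) (k : ℕ) :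
    (headDiag p m d x : lp (fun _ : ℕ => ℝ) p) k =
      if k < m then d k * (x : lp (fun _ : ℕ => ℝ) p) k else 0 := rfl

theorem headDiag_det (p : ℝ≥0∞) [Fact (1 ≤ p)] (m : ℕ) (d : ℕ → ℝ) :
    LinearMap.det (headDiag p m d) = ∏ i ∈ Finset.range m, d i := by
  rw [← LinearMap.det_conj (headDiag p m d) (headEquiv p m)]
  have : ((headEquiv p m).toLinearMap ∘ₗ headDiag p m d ∘ₗ (headEquiv p m).symm.toLinearMap)
      = Matrix.toLin' (Matrix.diagonal (fun i : Fin m => d i)) := by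
    apply LinearMap.ext
    intro v
    funext i
    rw [Matrix.toLin'_apply, Matrix.mulVec_diagonal]
    obtain ⟨x, rfl⟩ := (headEquiv p m).surjective v
    simp only [LinearMap.comp_apply, LinearEquiv.coe_coe, LinearEquiv.symm_apply_apply]
    change (headDiag p m d x : lp (fun _ : ℕ => ℝ) p) i = d i * (x : lp (fun _ : ℕ => ℝ) p) i
    rw [headDiag_apply]
    simp
  rw [this, LinearMap.det_toLin', Matrix.det_diagonal, Finset.prod_range]

theorem head_cov (p : ℝ≥0∞) [Fact (1 ≤ p)] (m : ℕ) (σ : ℕ → ℝ) (hσ : ∀ k, 0 < σ k)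
    (δ : ℝ) (hδ : 0 < δ) (n : ℕ) (hn : 1 ≤ n)
    (hprod : ∏ i ∈ Finset.range m, (2 * σ i + δ) ≤ (δ / 2) ^ m * n) :
    ∃ y : Fin n → headSub p m, ∀ x : lp (fun _ : ℕ => ℝ) p, ‖x‖ ≤ 1 →
      ∃ i, ‖headMk p m (fun k => σ k * x k) - y i‖ ≤ δ := by
  have : FiniteDimensional ℝ (headSub p m) := (headEquiv p m).symm.finiteDimensional
  have hp0 : p ≠ 0 := (zero_lt_one.trans_le (Fact.out : 1 ≤ p)).ne'
  have hfr : Module.finrank ℝ (headSub p m) = m := by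
    rw [(headEquiv p m).finrank_eq]; simp
  obtain ⟨y, hy⟩ := cov_aux
    ((fun x : lp (fun _ : ℕ => ℝ) p => headMk p m (fun k => σ k * x k)) '' closedBall 0 1)
    (headDiag p m (fun k => 2 * σ k + δ)) δ hδ n hn (by
      rintro _ ⟨x, hx, rfl⟩ v hv
      rw [mem_closedBall_zero_iff] at hx
      rw [mem_closedBall, dist_eq_norm] at hv
      set g := v - headMk p m (fun k => σ k * x k) with hg
      have hd : ∀ k, 0 < 2 * σ k + δ := fun k => by linarith [hσ k]
      refine ⟨headMk p m (fun k => (v : lp (fun _ : ℕ => ℝ) p) k / (2 * σ k + δ)), ?_, ?_⟩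
      · rw [mem_closedBall_zero_iff]
        set a := headMk p m (fun k => σ k * x k / (2 * σ k + δ)) with ha
        set b := headMk p m (fun k => (g : lp (fun _ : ℕ => ℝ) p) k / (2 * σ k + δ)) with hb
        have hab : headMk p m (fun k => (v : lp (fun _ : ℕ => ℝ) p) k / (2 * σ k + δ)) = a + b := by
          apply head_ext
          intro k hk
          simp [ha, hb, hg, headMk_apply, hk]
          ring
        rw [hab]
        have h1 : ‖a‖ ≤ 1 / 2 := by
          have : ‖(a : lp (fun _ : ℕ => ℝ) p)‖ ≤ ‖((1:ℝ)/2) • x‖ := by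
            apply lp.norm_mono hp0
            intro k
            rw [ha, headMk_apply]
            split_ifs
            · simp only [lp.coeFn_smul, Pi.smul_apply, smul_eq_mul, norm_mul, norm_div,
                Real.norm_eq_abs, abs_of_pos (hσ k), abs_of_pos (hd k)]
              rw [div_le_iff₀ (hd k)]
              norm_num
              nlinarith [abs_nonneg (x k), hσ k]
            · simp
          rw [norm_smul] at this
          refine le_trans this ?_
          norm_num
          linarith
        have h2 : ‖b‖ ≤ 1 / 2 := by
          have : ‖(b : lp (fun _ : ℕ => ℝ) p)‖ ≤ ‖((1:ℝ)/δ) • (g : lp (fun _ : ℕ => ℝ) p)‖ := by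
            apply lp.norm_mono hp0
            intro k
            rw [hb, headMk_apply]
            split_ifs
            · simp only [lp.coeFn_smul, Pi.smul_apply, smul_eq_mul, norm_mul, norm_div,
                Real.norm_eq_abs, abs_of_pos (hd k), abs_of_pos hδ, abs_one]
              rw [one_div_mul_eq_div]
              exact div_le_div_of_nonneg_left (abs_nonneg _) hδ (by linarith [hσ k])
            · simp only [norm_zero]; exact norm_nonneg _
          rw [norm_smul] at this
          refine le_trans this ?_
          rw [Real.norm_eq_abs, abs_of_pos (by positivity), one_div_mul_eq_div, div_le_iff₀ hδ]
          change ‖g‖ ≤ _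
          linarith
        linarith [norm_add_le a b]
      · apply head_ext
        intro k hk
        rw [headDiag_apply, headMk_apply, if_pos hk, if_pos hk]
        field_simp [(hd k).ne'])
    (by
      rw [headDiag_det, hfr, abs_of_nonneg]
      · exact hprod
      · exact Finset.prod_nonneg fun i _ => by linarith [hσ i])
  refine ⟨y, fun x hx => ?_⟩
  have := hy ⟨x, by simpa using hx, rfl⟩
  obtain ⟨i, hi⟩ := Set.mem_iUnion.1 this
  exact ⟨i, by simpa [dist_eq_norm] using hi⟩

theorem tail_nonneg (r : ℝ) (σ : ℕ → ℝ) (hσpos : ∀ k, 0 < σ k) (k : ℕ) : 0 ≤ tailSeq r σ k := by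
  unfold tailSeq
  refine Real.rpow_nonneg (tsum_nonneg fun j => ?_) _
  split_ifs
  · exact Real.rpow_nonneg (hσpos j).le _
  · exact le_rfl

theorem tail_summable (r : ℝ) (σ : ℕ → ℝ) (hσpos : ∀ k, 0 < σ k)
    (hs : Summable (fun k : ℕ => σ k ^ r)) (k : ℕ) :
    Summable (fun j : ℕ => if k ≤ j then σ j ^ r else 0) := by
  refine Summable.of_nonneg_of_le (fun j => ?_) (fun j => ?_) hs
  · split_ifs
    · exact Real.rpow_nonneg (hσpos j).le _
    · exact le_rfl
  · split_ifs
    · exact le_rfl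
    · exact Real.rpow_nonneg (hσpos j).le _

theorem tail_le (r : ℝ) (hr : 0 < r) (σ : ℕ → ℝ) (hσpos : ∀ k, 0 < σ k)
    (hs : Summable (fun k : ℕ => σ k ^ r)) (k : ℕ) : tailSeq r σ k ≤ tailSeq r σ 0 := by
  unfold tailSeq
  refine Real.rpow_le_rpow (tsum_nonneg fun j => ?_) ?_ (by positivity)
  · split_ifs
    · exact Real.rpow_nonneg (hσpos j).le _
    · exact le_rfl
  · refine Summable.tsum_le_tsum (fun j => ?_) (tail_summable r σ hσpos hs k)
      (tail_summable r σ hσpos hs 0)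
    have := Real.rpow_nonneg (hσpos j).le r
    split_ifs <;> simp_all

theorem tail_tendsto (r : ℝ) (hr : 0 < r) (σ : ℕ → ℝ) (hσpos : ∀ k, 0 < σ k)
    (hs : Summable (fun k : ℕ => σ k ^ r)) : Tendsto (tailSeq r σ) atTop (nhds 0) := by
  have h := tendsto_tsum_of_dominated_convergence (𝓕 := atTop)
    (f := fun k j : ℕ => if k ≤ j then σ j ^ r else 0) (g := fun _ => (0:ℝ)) hs
    (fun j => tendsto_const_nhds.congr' (by
      filter_upwards [eventually_gt_atTop j] with k hk
      simp [not_le.2 hk]))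
    (Eventually.of_forall fun k j => by
      have := Real.rpow_nonneg (hσpos j).le r
      split_ifs
      · simp [abs_of_nonneg this]
      · simpa using this)
  rw [tsum_zero] at h
  have h2 := h.rpow_const (p := 1 / r) (Or.inr (by positivity))
  rw [Real.zero_rpow (by positivity)] at h2
  exact h2

theorem bdd_aux (r : ℝ) (hr : 1 ≤ r) (σ : ℕ → ℝ) (hσpos : ∀ k, 0 < σ k)
    (hs : Summable (fun k : ℕ => σ k ^ r)) (n : ℕ) (hn : 1 ≤ n) :
    BddAbove (Set.range fun k : ℕ => ((∏ i ∈ Finset.range (k + 1),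
              (tailSeq r σ k + (k + 1 : ℝ) ^ (1 / r) * σ i)) / n)
            ^ (1 / (k + 1 : ℝ))) := by
  refine ⟨2 * tailSeq r σ 0, ?_⟩
  rintro _ ⟨k, rfl⟩
  have hr0 : 0 < r := by linarith
  have hk : (0:ℝ) < k + 1 := by positivity
  set c := (k + 1 : ℝ) ^ (1 / r) with hc
  have hc0 : 0 < c := by positivity
  have ht := tail_nonneg r σ hσpos k
  have hf : ∀ i, 0 ≤ tailSeq r σ k + c * σ i := fun i => by
    have := hσpos i
    positivity
  have hw : ∑ i ∈ Finset.range (k + 1), (1 / (k + 1 : ℝ)) = 1 := by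
    simp; field_simp
  have h1 : ((∏ i ∈ Finset.range (k + 1), (tailSeq r σ k + c * σ i)) / n) ^ (1 / (k + 1 : ℝ))
      ≤ (∏ i ∈ Finset.range (k + 1), (tailSeq r σ k + c * σ i)) ^ (1 / (k + 1 : ℝ)) := by
    have h0 := Finset.prod_nonneg (s := Finset.range (k+1)) fun i _ => hf i
    refine Real.rpow_le_rpow (by positivity) (div_le_self h0 (by exact_mod_cast hn)) (by positivity)
  refine h1.trans ?_
  rw [← Real.finsetProd_rpow _ _ (fun i _ => hf i)]
  refine (Real.geom_mean_le_arith_mean_weighted (Finset.range (k+1)) (fun _ => 1 / (k + 1 : ℝ))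
    (fun i => tailSeq r σ k + c * σ i) (fun _ _ => by positivity) hw (fun i _ => hf i)).trans ?_
  simp_rw [mul_add]
  rw [Finset.sum_add_distrib, ← Finset.sum_mul, hw, one_mul]
  have h2 := Real.rpow_arith_mean_le_arith_mean_rpow (Finset.range (k+1))
    (fun _ => 1 / (k + 1 : ℝ)) (fun i => c * σ i) (fun _ _ => by positivity) hw
    (fun i _ => mul_nonneg hc0.le (hσpos i).le) hr
  have h3 : ∑ i ∈ Finset.range (k+1), 1 / (k + 1 : ℝ) * (c * σ i) ^ r
      ≤ ∑' j, if 0 ≤ j then σ j ^ r else 0 := by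
    have : ∀ i, 1 / (k + 1 : ℝ) * (c * σ i) ^ r = σ i ^ r := fun i => by
      rw [Real.mul_rpow hc0.le (hσpos i).le, hc, ← Real.rpow_mul hk.le, one_div_mul_cancel hr0.ne',
        Real.rpow_one]
      field_simp
    simp_rw [this]
    simpa using hs.sum_le_tsum _ (fun i _ => Real.rpow_nonneg (hσpos i).le _)
  have h4 : ∑ i ∈ Finset.range (k+1), 1 / (k + 1 : ℝ) * (c * σ i) ≤ tailSeq r σ 0 := by
    have h0 : 0 ≤ ∑ i ∈ Finset.range (k+1), 1 / (k + 1 : ℝ) * (c * σ i) :=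
      Finset.sum_nonneg fun i _ => by have := hσpos i; positivity
    have := Real.rpow_le_rpow (Real.rpow_nonneg h0 r) (h2.trans h3) (by positivity : 0 ≤ 1 / r)
    rwa [← Real.rpow_mul h0, mul_one_div_cancel hr0.ne', Real.rpow_one] at this
  linarith [tail_le r hr0 σ hσpos hs k]

/-- **Theorem 2 (upper bound for `p > q`).**
Let `1 ≤ q < p ≤ ∞` with `1/q = 1/p + 1/r`, and let `σ` be a non-increasing sequence of
positive reals tending to zero with `∑_k σ_k^r < ∞` (here `σ k` denotes the `(k+1)`-st
term `σ_{k+1}` of the paper, and `tailSeq r.toReal σ k` is the tail `τ_{k+1}`).  Then the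
entropy numbers of the diagonal operator `D_σ : ℓ_p → ℓ_q` satisfy
`e_n(D_σ) ≤ C ⬝ sup_{k ≥ 1} ((τ_k + k^{1/r} σ_1)⋯(τ_k + k^{1/r} σ_k)/n)^{1/k}`. -/
theorem statement2 (p q r : ℝ≥0∞) [Fact (1 ≤ p)] [Fact (1 ≤ q)]
    (hqp : q < p) (hr : 1 / q = 1 / p + 1 / r)
    (σ : ℕ → ℝ) (hσpos : ∀ k, 0 < σ k) (hσanti : Antitone σ)
    (hσlim : Tendsto σ atTop (nhds 0))
    (hσsum : Summable (fun k : ℕ => σ k ^ r.toReal))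
    (D : lp (fun _ : ℕ => ℝ) p →L[ℝ] lp (fun _ : ℕ => ℝ) q)
    (hD : ∀ (x : lp (fun _ : ℕ => ℝ) p) (k : ℕ), D x k = σ k * x k) :
    ∃ C : ℝ, 0 < C ∧ ∀ n : ℕ, 1 ≤ n →
      entropyNumber n (D '' Metric.closedBall 0 1) ≤
        C * ⨆ k : ℕ,
          ((∏ i ∈ Finset.range (k + 1),
              (tailSeq r.toReal σ k + (k + 1 : ℝ) ^ (1 / r.toReal) * σ i)) / n)
            ^ (1 / (k + 1 : ℝ)) := by
  have hp1 : 1 ≤ p := Fact.out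
  have hq1 : 1 ≤ q := Fact.out
  have hqt : q ≠ ⊤ := hqp.ne_top
  have hrt : r ≠ ⊤ := by
    rintro rfl
    simp at hr
    exact hqp.ne hr
  have hqr : q ≤ r := by
    have : 1 / r ≤ 1 / q := by rw [hr]; exact le_add_self
    simpa using this
  have hfr : Fact (1 ≤ r) := ⟨hq1.trans hqr⟩
  have hR : 1 ≤ r.toReal := by
    have := ENNReal.toReal_mono hrt hfr.out
    simpa using this
  have hR0 : 0 < r.toReal := by linarith
  set R := r.toReal with hRdef
  set t := tailSeq R σ with ht
  have ht0 : ∀ k, 0 ≤ t k := tail_nonneg R σ hσpos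
  -- tail estimate
  have htail : ∀ (k : ℕ) (x : lp (fun _ : ℕ => ℝ) p) (z : lp (fun _ : ℕ => ℝ) q), ‖x‖ ≤ 1 →
      (∀ j, |z j| ≤ (if k ≤ j then σ j else 0) * |x j|) → ‖z‖ ≤ t k := by
    intro k x z hx hz
    have hite : ∀ j, (if k ≤ j then σ j else 0) ^ R = if k ≤ j then σ j ^ R else 0 := by
      intro j
      split_ifs
      · rfl
      · exact Real.zero_rpow hR0.ne'
    have := holder_aux p q r hr hR0 (fun j => if k ≤ j then σ j else 0)
      (fun j => by split_ifs; exacts [(hσpos j).le, le_rfl])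
      (by simp_rw [← hRdef, hite]; exact tail_summable R σ hσpos hσsum k) x z hz
    simp_rw [← hRdef, hite] at this
    refine this.trans ?_
    change t k * ‖x‖ ≤ t k
    exact mul_le_of_le_one_right (ht0 k) hx
  refine ⟨8, by norm_num, fun n hn => ?_⟩
  have hbdd := bdd_aux R hR σ hσpos hσsum n hn
  set P : ℕ → ℝ := fun k => ∏ i ∈ Finset.range (k + 1), (t k + (k + 1 : ℝ) ^ (1 / R) * σ i) with hP
  set s := ⨆ k : ℕ, (P k / n) ^ (1 / (k + 1 : ℝ)) with hs
  change _ ≤ 8 * s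
  have hn0 : (0:ℝ) < n := by exact_mod_cast hn
  have hPpos : ∀ k, 0 < P k := fun k => Finset.prod_pos fun i _ => by
    have := hσpos i
    have := ht0 k
    positivity
  have hle : ∀ k, (P k / n) ^ (1 / (k + 1 : ℝ)) ≤ s := fun k => le_ciSup hbdd k
  have hs0 : 0 < s := lt_of_lt_of_le (by have := hPpos 0; positivity) (hle 0)
  have hPle : ∀ k, P k ≤ n * s ^ (k + 1) := by
    intro k
    have h0 : 0 ≤ P k / n := (div_pos (hPpos k) hn0).le
    have h1 := pow_le_pow_left₀ (Real.rpow_nonneg h0 _) (hle k) (k + 1)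
    rw [← Real.rpow_natCast, ← Real.rpow_mul h0] at h1
    push_cast at h1
    rw [one_div_mul_cancel (by positivity), Real.rpow_one, div_le_iff₀ hn0] at h1
    linarith
  refine csInf_le ⟨0, fun ε hε => hε.1.le⟩ ⟨by positivity, ?_⟩
  by_cases hcase : t 0 ≤ 4 * s
  · refine ⟨fun _ => 0, ?_⟩
    rintro _ ⟨x, hx, rfl⟩
    rw [mem_closedBall_zero_iff] at hx
    refine Set.mem_iUnion.2 ⟨⟨0, hn⟩, ?_⟩
    rw [mem_closedBall_zero_iff]
    have := htail 0 x (D x) hx (fun j => by simp [hD, abs_mul, abs_of_pos (hσpos j)])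
    linarith
  -- choose the dimension
  have hex : ∃ M, t M ≤ 4 * s := by
    have := (tail_tendsto R hR0 σ hσpos hσsum).eventually (ge_mem_nhds (by positivity : 0 < 4 * s))
    exact this.exists
  classical
  obtain ⟨k, hk1, hk2⟩ : ∃ k, 4 * s < t k ∧ t (k + 1) ≤ 4 * s := by
    obtain ⟨k, hk⟩ : ∃ k, Nat.find hex = k + 1 := by
      refine Nat.exists_eq_succ_of_ne_zero fun h => hcase ?_
      have := Nat.find_spec hex
      rwa [h] at this
    refine ⟨k, not_le.1 (Nat.find_min hex (by omega)), ?_⟩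
    have := Nat.find_spec hex
    rwa [hk] at this
  set c := (k + 1 : ℝ) ^ (1 / R) with hc
  have hc0 : 0 < c := by positivity
  set δ := 4 * s / c with hδ
  have hδ0 : 0 < δ := by positivity
  obtain ⟨y, hy⟩ := head_cov p (k + 1) σ hσpos δ hδ0 n hn (by
    calc ∏ i ∈ Finset.range (k + 1), (2 * σ i + δ)
        ≤ ∏ i ∈ Finset.range (k + 1), ((δ / 2) * (1 / s) * (t k + c * σ i)) := by
          refine Finset.prod_le_prod (fun i _ => by linarith [hσpos i]) fun i _ => ?_
          have e1 : δ / 2 * (1 / s) * (t k + c * σ i) = 2 * t k / c + 2 * σ i := by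
            rw [hδ]; field_simp; ring
          have e2 : δ ≤ t k / c := by rw [hδ]; gcongr
          have e3 : 0 ≤ t k / c := div_nonneg (ht0 k) hc0.le
          rw [e1, mul_div_assoc]
          linarith
      _ = (δ / 2) ^ (k + 1) * ((1 / s) ^ (k + 1) * P k) := by
          rw [Finset.prod_mul_distrib, Finset.prod_const, Finset.card_range, mul_pow, mul_assoc]
      _ ≤ (δ / 2) ^ (k + 1) * ((1 / s) ^ (k + 1) * (n * s ^ (k + 1))) := by
          have := hPle k
          gcongr
      _ = (δ / 2) ^ (k + 1) * n := by
          congr 1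
          rw [mul_left_comm, ← mul_pow, one_div_mul_cancel hs0.ne', one_pow, mul_one])
  -- the centres
  refine ⟨fun i => (headMk q (k + 1) (fun j => (y i : lp (fun _ : ℕ => ℝ) p) j) :
    lp (fun _ : ℕ => ℝ) q), ?_⟩
  rintro _ ⟨x, hx, rfl⟩
  rw [mem_closedBall_zero_iff] at hx
  obtain ⟨i, hi⟩ := hy x hx
  refine Set.mem_iUnion.2 ⟨i, ?_⟩
  rw [mem_closedBall, dist_eq_norm]
  set u := headMk p (k + 1) (fun j => σ j * x j) - y i with hu
  set h1 : lp (fun _ : ℕ => ℝ) q := (headMk q (k + 1) (fun j => σ j * x j)).1 with hh1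
  set h2 : lp (fun _ : ℕ => ℝ) q := (headMk q (k + 1)
    (fun j => (y i : lp (fun _ : ℕ => ℝ) p) j)).1 with hh2
  have hA : ‖D x - h1‖ ≤ t (k + 1) := by
    refine htail (k + 1) x _ hx fun j => ?_
    have : (D x - h1) j = D x j - (if j < k + 1 then σ j * x j else 0) := rfl
    rw [this, hD]
    by_cases hj : j < k + 1
    · rw [if_pos hj, if_neg (by omega), sub_self, abs_zero, zero_mul]
    · rw [if_neg hj, if_pos (by omega), sub_zero, abs_mul, abs_of_pos (hσpos j)]
  have hB : ‖h1 - h2‖ ≤ c * δ := by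
    have hite : ∀ j : ℕ, (if j < k + 1 then (1:ℝ) else 0) ^ R = if j < k + 1 then 1 else 0 := by
      intro j
      split_ifs
      · exact Real.one_rpow _
      · exact Real.zero_rpow hR0.ne'
    have hzero : ∀ j ∉ Finset.range (k + 1), (if j < k + 1 then (1:ℝ) else 0) = 0 := by
      intro j hj
      rw [Finset.mem_range] at hj
      simp only [hj, if_false]
    have := holder_aux p q r hr hR0 (fun j => if j < k + 1 then 1 else 0)
      (fun j => by split_ifs <;> norm_num)
      (by simp_rw [← hRdef, hite]; exact summable_of_ne_finset_zero hzero)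
      (u : lp (fun _ : ℕ => ℝ) p) (h1 - h2) (fun j => by
        have e1 : (h1 - h2) j = (if j < k + 1 then σ j * x j else 0)
          - (if j < k + 1 then (y i : lp (fun _ : ℕ => ℝ) p) j else 0) := rfl
        have e2 : (u : lp (fun _ : ℕ => ℝ) p) j = (if j < k + 1 then σ j * x j else 0)
          - (y i : lp (fun _ : ℕ => ℝ) p) j := rfl
        rw [e1, e2]
        by_cases hj : j < k + 1
        · simp only [hj, if_true, one_mul]; exact le_rfl
        · simp only [hj, if_false, zero_mul, sub_self, abs_zero]; exact le_rfl)
    simp_rw [← hRdef, hite] at this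
    rw [tsum_eq_sum hzero] at this
    have e3 : ∑ j ∈ Finset.range (k + 1), (if j < k + 1 then (1:ℝ) else 0) = k + 1 := by
      rw [Finset.sum_congr rfl (fun j hj => if_pos (Finset.mem_range.1 hj))]
      simp
    rw [e3] at this
    refine this.trans ?_
    have hi' : ‖(u : lp (fun _ : ℕ => ℝ) p)‖ ≤ δ := hi
    gcongr
  have hcδ : c * δ = 4 * s := by rw [hδ]; field_simp
  calc ‖D x - h2‖ = ‖(D x - h1) + (h1 - h2)‖ := by congr 1; abel
    _ ≤ ‖D x - h1‖ + ‖h1 - h2‖ := norm_add_le _ _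
    _ ≤ 8 * s := by linarith
end

section
/- Let 1 ≤ q < p ≤ ∞ with 1/q = 1/p + 1/r, and let σ = (σ_k)_{k≥1} be a non-increasing sequence of positive real numbers with σ_k → 0 and ∑_{k≥1} σ_k^r < ∞, with tail sequence τ_k = (∑_{n≥k} σ_n^r)^{1/r}. Assume condition (ALP): there exists c > 0 such that τ_n ≤ c · σ_n · n^{1/r} for all n ≥ 1. Then there exist constants c₁, c₂ > 0 such that for all n ≥ 1, c₁ · sup_{k≥1} k^{1/r} (σ_1·σ_2·…·σ_k / n)^{1/k} ≤ e_n(D_σ) ≤ c₂ · sup_{k≥1} k^{1/r} (σ_1·σ_2·…·σ_k / n)^{1/k}, where e_n(D_σ) is the n-th entropy number of the diagonal operator D_σ : ℓ_p → ℓ_q. -/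
open Metric Filter
open scoped ENNReal

noncomputable def hd (s : ℝ≥0∞) (K : ℕ) (f : ℕ → ℝ) : lp (fun _ : ℕ => ℝ) s :=
  ⟨fun i => if i < K then f i else 0, by
    refine Memℓp.of_exponent_ge (memℓp_zero ?_) zero_le
    refine (Set.finite_lt_nat K).subset ?_
    intro i hi
    by_contra h
    simp at h
    simp [not_lt.2 h] at hi⟩

lemma hd_apply (s : ℝ≥0∞) (K : ℕ) (f : ℕ → ℝ) (i : ℕ) :
    hd s K f i = if i < K then f i else 0 := rfl

lemma lp_l1 (s : ℝ≥0∞) [hs : Fact (1 ≤ s)] (x : lp (fun _ : ℕ => ℝ) s) (K : ℕ) (hK : 0 < K) :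
    ∑ i ∈ Finset.range K, |x i| ≤ (K : ℝ) ^ (1 - 1 / s.toReal) * ‖x‖ := by
  have hK' : (0:ℝ) < K := by exact_mod_cast hK
  have hs0 : s ≠ 0 := (zero_lt_one.trans_le hs.out).ne'
  rcases eq_or_ne s ∞ with h | h
  · calc ∑ i ∈ Finset.range K, |x i| ≤ ∑ i ∈ Finset.range K, ‖x‖ :=
          Finset.sum_le_sum fun i _ => lp.norm_apply_le_norm hs0 x i
      _ = _ := by simp [h]
  · have hs1 : 1 ≤ s.toReal := by
      simpa using ENNReal.toReal_mono h hs.out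
    have hp : 0 < s.toReal := by linarith
    have h1 := Real.rpow_sum_le_const_mul_sum_rpow (Finset.range K) (fun i => x i) hs1
    have h2 := lp.sum_rpow_le_norm_rpow hp x (Finset.range K)
    rw [← Real.rpow_le_rpow_iff (Finset.sum_nonneg fun _ _ => abs_nonneg _) (by positivity) hp]
    refine h1.trans ?_
    rw [Real.mul_rpow (by positivity) (by positivity), ← Real.rpow_mul hK'.le]
    have e : (1 - 1 / s.toReal) * s.toReal = s.toReal - 1 := by field_simp
    rw [e, Finset.card_range]
    gcongr
    exact h2

lemma lp_box (s : ℝ≥0∞) [hs : Fact (1 ≤ s)] (x : lp (fun _ : ℕ => ℝ) s) (K : ℕ) (hK : 0 < K)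
    (d : ℝ) (hd : 0 ≤ d) (h1 : ∀ i < K, |x i| ≤ d) (h2 : ∀ i, K ≤ i → x i = 0) :
    ‖x‖ ≤ (K : ℝ) ^ (1 / s.toReal) * d := by
  have hK' : (0:ℝ) < K := by exact_mod_cast hK
  rcases eq_or_ne s ∞ with h | h
  · subst h
    refine lp.norm_le_of_forall_le (by positivity) ?_
    intro i
    rcases lt_or_ge i K with h | h
    · simpa using h1 i h
    · simp [h2 i h, hd]
  · have hs1 : 1 ≤ s.toReal := by
      simpa using ENNReal.toReal_mono h hs.out
    have hp : 0 < s.toReal := by linarith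
    refine lp.norm_le_of_tsum_le hp (by positivity) ?_
    rw [tsum_eq_sum (s := Finset.range K)]
    · rw [Real.mul_rpow (by positivity) hd, ← Real.rpow_mul hK'.le, one_div_mul_cancel hp.ne',
        Real.rpow_one]
      calc _ ≤ ∑ i ∈ Finset.range K, d ^ s.toReal := by
            refine Finset.sum_le_sum fun i hi => ?_
            exact Real.rpow_le_rpow (norm_nonneg _) (h1 i (Finset.mem_range.1 hi)) hp.le
        _ = _ := by simp
    · intro i hi
      rw [h2 i (by simpa using hi), norm_zero, Real.zero_rpow hp.ne']

lemma exps (p q r : ℝ≥0∞) [hp : Fact (1 ≤ p)] [hq : Fact (1 ≤ q)]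
    (hqp : q < p) (hr : 1 / q = 1 / p + 1 / r) :
    1 ≤ q.toReal ∧ 0 < r.toReal ∧ 1 / q.toReal = 1 / p.toReal + 1 / r.toReal := by
  have hqt : q ≠ ∞ := hqp.ne_top
  have hq0 : q ≠ 0 := (zero_lt_one.trans_le hq.out).ne'
  have hp0 : p ≠ 0 := (zero_lt_one.trans_le hp.out).ne'
  have hr0 : r ≠ 0 := by
    rintro rfl
    simp at hr
    exact hq0 hr
  have hrt : r ≠ ∞ := by
    rintro rfl
    simp at hr
    exact hqp.ne hr
  refine ⟨by simpa using ENNReal.toReal_mono hqt hq.out, ENNReal.toReal_pos hr0 hrt, ?_⟩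
  have := congrArg ENNReal.toReal hr
  rw [ENNReal.toReal_add (by simp [hp0]) (by simp [hr0])] at this
  simpa using this

lemma tail_bound (p q r : ℝ≥0∞) [hp : Fact (1 ≤ p)] [hq : Fact (1 ≤ q)]
    (hqp : q < p) (hr : 1 / q = 1 / p + 1 / r)
    (σ : ℕ → ℝ) (hσpos : ∀ k, 0 < σ k)
    (hσsum : Summable (fun k : ℕ => σ k ^ r.toReal)) (K : ℕ)
    (x : lp (fun _ : ℕ => ℝ) p) (z : lp (fun _ : ℕ => ℝ) q) (hx : ‖x‖ ≤ 1)
    (hz : ∀ i, z i = if K ≤ i then σ i * x i else 0) : ‖z‖ ≤ tailSeq r.toReal σ K := by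
  obtain ⟨hq1, hr0, hE⟩ := exps p q r hqp hr
  have hq0 : 0 < q.toReal := by linarith
  have hp0 : p ≠ 0 := (zero_lt_one.trans_le hp.out).ne'
  have hnn : ∀ j, 0 ≤ (if K ≤ j then σ j ^ r.toReal else 0) := by
    intro j; split_ifs
    · exact Real.rpow_nonneg (hσpos j).le _
    · exact le_rfl
  have hsum : Summable (fun j => if K ≤ j then σ j ^ r.toReal else 0) := by
    refine Summable.of_nonneg_of_le hnn (fun j => ?_) hσsum
    split_ifs
    · exact le_rfl
    · exact Real.rpow_nonneg (hσpos j).le _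
  have hT : 0 ≤ ∑' j, (if K ≤ j then σ j ^ r.toReal else 0) := tsum_nonneg hnn
  have hτ : 0 ≤ tailSeq r.toReal σ K := Real.rpow_nonneg hT _
  have hτr : tailSeq r.toReal σ K ^ q.toReal
      = (∑' j, (if K ≤ j then σ j ^ r.toReal else 0)) ^ (q.toReal / r.toReal) := by
    unfold tailSeq
    rw [← Real.rpow_mul hT]; congr 1; ring
  refine lp.norm_le_of_forall_sum_le hq0 hτ ?_
  intro S
  rw [hτr]
  have hfin : ∑ j ∈ S, (if K ≤ j then σ j ^ r.toReal else 0) ≤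
    ∑' j, (if K ≤ j then σ j ^ r.toReal else 0) := hsum.sum_le_tsum S (fun j _ => hnn j)
  have hz' : ∀ i, ‖z i‖ ^ q.toReal
      = (if K ≤ i then σ i ^ q.toReal else 0) * |x i| ^ q.toReal := by
    intro i
    rw [hz]
    split_ifs
    · rw [norm_mul, Real.norm_of_nonneg (hσpos i).le, Real.mul_rpow (hσpos i).le (norm_nonneg _)]
      rfl
    · simp [hq0.ne']
  rcases eq_or_ne p ∞ with h | h
  · have hqr : q.toReal = r.toReal := by
      simp [h] at hE
      exact hE
    rw [hqr, div_self hr0.ne', Real.rpow_one]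
    refine le_trans (Finset.sum_le_sum fun i _ => ?_) hfin
    rw [← hqr, hz', hqr]
    refine mul_le_of_le_one_right (hnn i) ?_
    exact Real.rpow_le_one (abs_nonneg _) ((lp.norm_apply_le_norm hp0 x i).trans hx) hr0.le
  · have hpp : 0 < p.toReal := ENNReal.toReal_pos hp0 h
    have hc : Real.HolderConjugate (r.toReal / q.toReal) (p.toReal / q.toReal) := by
      refine ⟨?_, by positivity, by positivity⟩
      have : q.toReal * (1 / q.toReal) = 1 := mul_one_div_cancel hq0.ne'
      rw [hE] at this
      rw [inv_div, inv_div, inv_one, ← this]; ring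
    have hH := Real.inner_le_Lp_mul_Lq_of_nonneg S
      (f := fun i => if K ≤ i then σ i ^ q.toReal else 0) (g := fun i => |x i| ^ q.toReal) hc
      (fun i _ => by split_ifs; exacts [Real.rpow_nonneg (hσpos i).le _, le_rfl])
      (fun i _ => by positivity)
    simp only [hz']
    refine hH.trans ?_
    have e1 : ∀ i, (if K ≤ i then σ i ^ q.toReal else 0) ^ (r.toReal / q.toReal)
        = if K ≤ i then σ i ^ r.toReal else 0 := by
      intro i
      split_ifs
      · rw [← Real.rpow_mul (hσpos i).le]; congr 1; field_simp
      · exact Real.zero_rpow (by positivity)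
    have e2 : ∀ i, (|x i| ^ q.toReal) ^ (p.toReal / q.toReal) = |x i| ^ p.toReal := by
      intro i
      rw [← Real.rpow_mul (abs_nonneg _)]; congr 1; field_simp
    simp only [e1, e2, one_div_div]
    have h3 : ∑ i ∈ S, |x i| ^ p.toReal ≤ 1 :=
      (lp.sum_rpow_le_norm_rpow hpp x S).trans (Real.rpow_le_one (norm_nonneg _) hx hpp.le)
    have h4 : (∑ i ∈ S, |x i| ^ p.toReal) ^ (q.toReal / p.toReal) ≤ 1 :=
      Real.rpow_le_one (Finset.sum_nonneg fun i _ => by positivity) h3 (by positivity)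
    have h5 := Real.rpow_le_rpow (Finset.sum_nonneg fun i _ => hnn i) hfin
      (show 0 ≤ q.toReal / r.toReal by positivity)
    exact (mul_le_of_le_one_right (Real.rpow_nonneg (Finset.sum_nonneg fun i _ => hnn i) _) h4).trans h5

lemma exists_trunc (t : ℝ) : ∃ m : ℤ, |(m:ℝ)| ≤ |t| ∧ |t - m| ≤ 1 := by
  rcases le_total 0 t with h | h
  · refine ⟨⌊t⌋, ?_, ?_⟩
    · rw [abs_of_nonneg h, abs_of_nonneg (by exact_mod_cast Int.floor_nonneg.2 h)]
      exact Int.floor_le t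
    · rw [abs_le]; constructor <;> linarith [Int.floor_le t, Int.lt_floor_add_one t]
  · refine ⟨⌈t⌉, ?_, ?_⟩
    · have : ((⌈t⌉ : ℤ) : ℝ) ≤ 0 := by exact_mod_cast Int.ceil_le.2 (by simpa using h)
      rw [abs_of_nonpos h, abs_of_nonpos this]
      linarith [Int.le_ceil t]
    · rw [abs_le]; constructor <;> linarith [Int.le_ceil t, Int.ceil_lt_add_one t]

lemma geo (s : ℝ) (h0 : 0 < s) (h1 : s ≤ 1) (L : ℕ) :
    ∑ m ∈ Finset.Icc (-(L:ℤ)) L, Real.exp (-(s * |(m:ℝ)|)) ≤ 4 / s := by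
  have hg : ∀ N : ℕ, ∑ j ∈ Finset.range N, Real.exp (-(s * j)) ≤ 2 / s := by
    intro N
    have e : ∀ j : ℕ, Real.exp (-(s * j)) = Real.exp (-s) ^ j := by
      intro j; rw [← Real.exp_nat_mul]; congr 1; ring
    simp only [e]
    have hlt : Real.exp (-s) < 1 := by simpa using h0
    have h2 : ∑ j ∈ Finset.range N, Real.exp (-s) ^ j ≤ (1 - Real.exp (-s))⁻¹ := by
      rw [← tsum_geometric_of_lt_one (Real.exp_pos _).le hlt]
      exact (summable_geometric_of_lt_one (Real.exp_pos _).le hlt).sum_le_tsum _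
        (fun _ _ => by positivity)
    refine h2.trans ?_
    have h3 : Real.exp (-s) ≤ 1 - s / 2 := by
      rw [Real.exp_neg]
      refine inv_le_of_inv_le₀ (by linarith) ?_
      have : (1 - s/2)⁻¹ ≤ 1 + s := by
        rw [inv_le_iff_one_le_mul₀ (by linarith)]
        nlinarith
      linarith [Real.add_one_le_exp s]
    rw [show 2 / s = (s/2)⁻¹ by rw [inv_div]]
    exact inv_anti₀ (by linarith) (by linarith)
  have hsub : Finset.Icc (-(L:ℤ)) L ⊆ (Finset.range (L+1)).image (fun j : ℕ => (j:ℤ)) ∪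
      (Finset.range (L+1)).image (fun j : ℕ => -(j:ℤ)) := by
    intro m hm
    simp only [Finset.mem_Icc] at hm
    simp only [Finset.mem_union, Finset.mem_image, Finset.mem_range]
    rcases le_total 0 m with h | h
    · exact Or.inl ⟨m.toNat, by omega, by omega⟩
    · exact Or.inr ⟨(-m).toNat, by omega, by omega⟩
  have hA := Finset.sum_le_sum_of_subset_of_nonneg (f := fun m : ℤ => Real.exp (-(s * |(m:ℝ)|)))
    hsub (fun _ _ _ => (Real.exp_pos _).le)
  have hB := Finset.sum_union_inter (s₁ := (Finset.range (L+1)).image (fun j : ℕ => (j:ℤ)))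
    (s₂ := (Finset.range (L+1)).image (fun j : ℕ => -(j:ℤ)))
    (f := fun m : ℤ => Real.exp (-(s * |(m:ℝ)|)))
  have hC : 0 ≤ ∑ m ∈ (Finset.range (L+1)).image (fun j : ℕ => (j:ℤ)) ∩
    (Finset.range (L+1)).image (fun j : ℕ => -(j:ℤ)), Real.exp (-(s * |(m:ℝ)|)) :=
    Finset.sum_nonneg fun _ _ => (Real.exp_pos _).le
  rw [Finset.sum_image (by intro a _ b _ h; simpa using h),
        Finset.sum_image (by intro a _ b _ h; simpa using h)] at hB
  have hD := hg (L+1)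
  simp only [Int.cast_natCast, Int.cast_neg, abs_neg, Nat.abs_cast] at hB
  have hE : 4 / s = 2 / s + 2 / s := by ring
  linarith

lemma count_lattice (K : ℕ) (s : Fin K → ℝ) (h0 : ∀ i, 0 < s i) (h1 : ∀ i, s i ≤ 1) :
    ∃ F : Finset (Fin K → ℤ), (F.card : ℝ) ≤ ∏ i, (4 * Real.exp 1 / s i) ∧
      ∀ m : Fin K → ℤ, ∑ i, s i * |(m i : ℝ)| ≤ K → m ∈ F := by
  obtain ⟨L, hL⟩ := exists_nat_ge (∑ i, (K:ℝ) / s i)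
  refine ⟨(Fintype.piFinset fun _ => Finset.Icc (-(L:ℤ)) L).filter
    (fun m => ∑ i, s i * |(m i : ℝ)| ≤ K), ?_, ?_⟩
  · rw [Finset.cast_card]
    calc _ ≤ ∑ m ∈ (Fintype.piFinset fun _ => Finset.Icc (-(L:ℤ)) L).filter
          (fun m : Fin K → ℤ => ∑ i, s i * |(m i : ℝ)| ≤ K),
            ∏ i, (Real.exp 1 * Real.exp (-(s i * |(m i:ℝ)|))) := by
          refine Finset.sum_le_sum fun m hm => ?_
          simp only [← Real.exp_add]
          rw [← Real.exp_sum]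
          refine Real.one_le_exp ?_
          rw [Finset.sum_add_distrib, Finset.sum_neg_distrib]
          simp
          exact (Finset.mem_filter.1 hm).2
      _ ≤ ∑ m ∈ (Fintype.piFinset fun _ => Finset.Icc (-(L:ℤ)) L),
            ∏ i : Fin K, (Real.exp 1 * Real.exp (-(s i * |(m i:ℝ)|))) :=
          Finset.sum_le_sum_of_subset_of_nonneg (Finset.filter_subset _ _)
            (fun _ _ _ => by positivity)
      _ = ∏ i, ∑ m ∈ Finset.Icc (-(L:ℤ)) L, (Real.exp 1 * Real.exp (-(s i * |(m:ℝ)|))) := by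
          rw [Finset.prod_univ_sum]
      _ ≤ _ := by
          refine Finset.prod_le_prod (fun i _ => by positivity) fun i _ => ?_
          rw [← Finset.mul_sum]
          calc _ ≤ Real.exp 1 * (4 / s i) := by
                gcongr; exact geo _ (h0 i) (h1 i) L
            _ = _ := by ring
  · intro m hm
    refine Finset.mem_filter.2 ⟨?_, hm⟩
    rw [Fintype.mem_piFinset]
    intro i
    have h2 : s i * |(m i:ℝ)| ≤ K :=
      (Finset.single_le_sum (f := fun i => s i * |(m i:ℝ)|)
        (fun j _ => mul_nonneg (h0 j).le (abs_nonneg _)) (Finset.mem_univ i)).trans hm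
    have h3 : |(m i:ℝ)| ≤ K / s i := by rw [le_div_iff₀ (h0 i)]; linarith
    have h4 : (K:ℝ) / s i ≤ ∑ i, (K:ℝ) / s i :=
      Finset.single_le_sum (f := fun i => (K:ℝ) / s i)
        (fun j _ => div_nonneg (Nat.cast_nonneg _) (h0 j).le) (Finset.mem_univ i)
    have h5 : |(m i:ℝ)| ≤ L := by linarith
    rw [Finset.mem_Icc, ← abs_le]
    exact_mod_cast h5

lemma ent_le {Y : Type*} [SeminormedAddCommGroup Y] (n : ℕ) (T : Set Y) (F : Finset Y)
    (hF : F.card ≤ n) (ε : ℝ) (hε : 0 < ε) (h : ∀ x ∈ T, ∃ y ∈ F, ‖x - y‖ ≤ ε) :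
    entropyNumber n T ≤ ε := by
  refine csInf_le ⟨0, fun a ha => ha.1.le⟩ ⟨hε, fun i =>
    if hi : (i:ℕ) < F.card then (F.equivFin.symm ⟨i, hi⟩ : Y) else 0, ?_⟩
  intro x hx
  obtain ⟨y, hy, hxy⟩ := h x hx
  rw [Set.mem_iUnion]
  refine ⟨Fin.castLE hF (F.equivFin ⟨y, hy⟩), ?_⟩
  simp [dist_eq_norm, hxy]

lemma lower_aux (p q r : ℝ≥0∞) [hp : Fact (1 ≤ p)] [hq : Fact (1 ≤ q)]
    (hqp : q < p) (hr : 1 / q = 1 / p + 1 / r)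
    (σ : ℕ → ℝ) (hσpos : ∀ k, 0 < σ k)
    (D : lp (fun _ : ℕ => ℝ) p →L[ℝ] lp (fun _ : ℕ => ℝ) q)
    (hD : ∀ (x : lp (fun _ : ℕ => ℝ) p) (k : ℕ), D x k = σ k * x k)
    (n : ℕ) (hn : 1 ≤ n) (N : ℕ) (hN : 0 < N) (ε : ℝ) (hε : 0 < ε)
    (y : Fin n → lp (fun _ : ℕ => ℝ) q)
    (hy : D '' Metric.closedBall 0 1 ⊆ ⋃ i, Metric.closedBall (y i) ε) :
    (N : ℝ) ^ (1 / r.toReal) * ((∏ i ∈ Finset.range N, σ i) / n) ^ (1 / (N : ℝ))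
      ≤ Real.exp 1 * ε := by
  obtain ⟨hq1, hr0, hE⟩ := exps p q r hqp hr
  have hN' : (0:ℝ) < N := by exact_mod_cast hN
  have hn' : (0:ℝ) < n := by exact_mod_cast hn
  have : Nonempty (Fin N) := ⟨⟨0, hN⟩⟩
  set P := 1 / p.toReal
  set Q := 1 / q.toReal
  set R := 1 / r.toReal
  set b : Fin N → ℝ := fun i => σ i * (N:ℝ) ^ (-P) with hb
  have hcov : Set.Icc (-b) b ⊆ ⋃ i : Fin n, (fun z : Fin N → ℝ => z + (fun j : Fin N => -(y i (j:ℕ)) : Fin N → ℝ)) ⁻¹'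
      {x : Fin N → ℝ | (∑ j, |x j| ^ (1:ℝ)) ^ (1 / (1:ℝ)) ≤ (N:ℝ) ^ (1 - Q) * ε} := by
    intro z hz
    let x : lp (fun _ : ℕ => ℝ) p := hd p N (fun j => if h : j < N then z ⟨j, h⟩ / σ j else 0)
    have hxa : ∀ (j : ℕ) (h : j < N), x j = z ⟨j, h⟩ / σ j := by
      intro j h
      simp [x, hd_apply, h]
    have hx : ‖x‖ ≤ 1 := by
      have := lp_box p x N hN ((N:ℝ) ^ (-P)) (by positivity) ?_ ?_
      · rw [← Real.rpow_add hN'] at this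
        simpa [P] using this
      · intro i hi
        rw [hxa i hi, abs_div, abs_of_pos (hσpos i), div_le_iff₀ (hσpos i), abs_le]
        have h1 := hz.1 ⟨i, hi⟩
        have h2 := hz.2 ⟨i, hi⟩
        simp only [hb, Pi.neg_apply] at h1 h2
        constructor <;> linarith
      · intro i hi
        simp [x, hd_apply, not_lt.2 hi]
    have hmem := hy ⟨x, by simpa using hx, rfl⟩
    rw [Set.mem_iUnion] at hmem ⊢
    obtain ⟨i, hi⟩ := hmem
    refine ⟨i, ?_⟩
    rw [mem_closedBall, dist_eq_norm] at hi
    have h3 := lp_l1 q (D x - y i) N hN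
    simp only [Set.mem_preimage, Set.mem_ofPred_eq, Real.rpow_one, div_one]
    rw [Finset.sum_range] at h3
    refine le_trans (le_of_eq ?_) (h3.trans (mul_le_mul_of_nonneg_left hi (by positivity)))
    refine Finset.sum_congr rfl fun j _ => ?_
    have : (D x - y i) (j:ℕ) = D x j - y i j := rfl
    rw [this, hD, hxa j j.2, mul_div_cancel₀ _ (hσpos j).ne']
    rfl
  have hv := (MeasureTheory.measure_mono (μ := MeasureTheory.volume) hcov).trans
    (MeasureTheory.measure_iUnion_le _)
  rw [tsum_fintype] at hv
  simp only [MeasureTheory.measure_preimage_add_right] at hv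
  rw [MeasureTheory.volume_sum_rpow_le (Fin N) (p := 1) le_rfl, Real.volume_Icc_pi] at hv
  have hbp : ∀ i, 0 < b i := fun i => mul_pos (hσpos i) (by positivity)
  have hprod : 0 ≤ ∏ i, (b i - (-b) i) :=
    Finset.prod_nonneg fun i _ => by simp only [Pi.neg_apply]; linarith [hbp i]
  rw [← ENNReal.ofReal_prod_of_nonneg
    (fun i _ => by simp only [Pi.neg_apply]; linarith [hbp i])] at hv
  rw [← ENNReal.ofReal_pow (by positivity), ← ENNReal.ofReal_mul (by positivity)] at hv
  simp only [Finset.sum_const, Finset.card_univ, Fintype.card_fin, nsmul_eq_mul, div_one] at hv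
  rw [← ENNReal.ofReal_natCast, ← ENNReal.ofReal_mul (by positivity)] at hv
  have hG : Real.Gamma (1 + 1) = 1 := by
    rw [one_add_one_eq_two]; exact Real.Gamma_two
  rw [hG, Real.Gamma_nat_eq_factorial, mul_one] at hv
  rw [ENNReal.ofReal_le_ofReal_iff (by positivity)] at hv
  have hL : ∏ i, (b i - (-b) i) = 2 ^ N * ((∏ i ∈ Finset.range N, σ i) * ((N:ℝ) ^ (-P)) ^ N) := by
    rw [Finset.prod_range]
    have : ∀ i, b i - (-b) i = 2 * (σ i * (N:ℝ) ^ (-P)) := by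
      intro i; simp only [hb, Pi.neg_apply]; ring
    simp only [this, Finset.prod_mul_distrib, Finset.prod_const, Finset.card_univ,
      Fintype.card_fin]
  rw [hL] at hv
  set Pr := ∏ i ∈ Finset.range N, σ i with hPi
  have hPi0 : 0 < Pr := Finset.prod_pos fun i _ => hσpos i
  have hfac : (N:ℝ) ^ N / N.factorial ≤ Real.exp 1 ^ N := by
    have := Real.pow_div_factorial_le_exp (x := N) hN'.le N
    rwa [← Real.exp_nat_mul, mul_one]
  have h1 : Pr * ((N:ℝ) ^ (-P)) ^ N ≤ n * ((ε * Real.exp 1 * (N:ℝ)^(-Q)) ^ N) := by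
    have h2 : (2:ℝ)^N * (Pr * ((N:ℝ) ^ (-P)) ^ N) ≤
        2 ^ N * (n * ((ε * (N:ℝ)^(-Q))^N * ((N:ℝ) ^ N / N.factorial))) := by
      refine hv.trans (le_of_eq ?_)
      have : (N:ℝ) ^ (1 - Q) = N * (N:ℝ)^(-Q) := by
        rw [sub_eq_add_neg, Real.rpow_add hN', Real.rpow_one]
      rw [this]
      ring
    have h3 := le_of_mul_le_mul_left h2 (by positivity)
    refine h3.trans ?_
    rw [show ε * Real.exp 1 * (N:ℝ)^(-Q) = (ε * (N:ℝ)^(-Q)) * Real.exp 1 by ring, mul_pow _ (Real.exp 1)]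
    gcongr
  have h4 : Pr / n ≤ (ε * Real.exp 1 * (N:ℝ)^(-R)) ^ N := by
    rw [div_le_iff₀ hn']
    have h5 : (N:ℝ)^(-R) = (N:ℝ)^(-Q) * ((N:ℝ)^(-P))⁻¹ := by
      rw [← Real.rpow_neg hN'.le, ← Real.rpow_add hN']; congr 1; linarith
    rw [h5, ← mul_assoc, mul_pow, inv_pow]
    have h6 : 0 < ((N:ℝ) ^ (-P)) ^ N := by positivity
    rw [mul_right_comm, ← div_eq_mul_inv, le_div_iff₀ h6]
    linarith
  have h7 : (Pr / n) ^ (1 / (N:ℝ)) ≤ ε * Real.exp 1 * (N:ℝ)^(-R) := by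
    have := Real.rpow_le_rpow (by positivity) h4 (show 0 ≤ 1 / (N:ℝ) by positivity)
    rwa [one_div, Real.pow_rpow_inv_natCast (by positivity) hN.ne', ← one_div] at this
  calc _ ≤ (N:ℝ) ^ R * (ε * Real.exp 1 * (N:ℝ)^(-R)) := by gcongr
    _ = _ := by
      rw [Real.rpow_neg hN'.le]
      have : (N:ℝ) ^ R ≠ 0 := by positivity
      field_simp

lemma head_cover (p q r : ℝ≥0∞) [hp : Fact (1 ≤ p)] [hq : Fact (1 ≤ q)]
    (hqp : q < p) (hr : 1 / q = 1 / p + 1 / r)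
    (σ : ℕ → ℝ) (hσpos : ∀ k, 0 < σ k) (hσanti : Antitone σ)
    (n : ℕ) (hn : 1 ≤ n) (J : ℕ)
    (hJ : (4 * Real.exp 1) ^ (J + 1) * (∏ i ∈ Finset.range (J + 1), σ i) ≤ n * σ J ^ (J + 1)) :
    ∃ F : Finset (lp (fun _ : ℕ => ℝ) q), F.card ≤ n ∧ ∀ x : lp (fun _ : ℕ => ℝ) p, ‖x‖ ≤ 1 →
      ∃ y ∈ F, ‖hd q (J + 1) (fun i => σ i * x i) - y‖ ≤
        4 * Real.exp 1 * ((J + 1 : ℝ) ^ (1 / r.toReal) *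
          ((∏ i ∈ Finset.range (J + 1), σ i) / n) ^ (1 / (J + 1 : ℝ))) := by
  obtain ⟨hq1, hr0, hE⟩ := exps p q r hqp hr
  have hn' : (0:ℝ) < n := by exact_mod_cast hn
  obtain ⟨K, hK⟩ : ∃ K, K = J + 1 := ⟨_, rfl⟩
  have hK0 : 0 < K := by omega
  have hK' : (0:ℝ) < K := by exact_mod_cast hK0
  have hKc : (J + 1 : ℝ) = K := by rw [hK]; push_cast; rfl
  rw [hKc]
  rw [← hK] at hJ ⊢
  set P := 1 / p.toReal
  set Q := 1 / q.toReal
  set R := 1 / r.toReal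
  set A := 4 * Real.exp 1
  have hA : 0 < A := by positivity
  set Pr := ∏ i ∈ Finset.range K, σ i with hPi
  have hPi0 : 0 < Pr := Finset.prod_pos fun i _ => hσpos i
  set g := (Pr / n) ^ (1 / (K:ℝ)) with hg
  have hg0 : 0 < g := by positivity
  have hgK : g ^ K = Pr / n := by
    rw [hg, one_div, Real.rpow_inv_natCast_pow (by positivity) hK0.ne']
  have hgJ : A * g ≤ σ J := by
    refine le_of_pow_le_pow_left₀ hK0.ne' (hσpos J).le ?_
    rw [mul_pow, hgK, ← mul_div_assoc, div_le_iff₀ hn']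
    linarith
  set δ := A * g * (K:ℝ) ^ (-P) with hδ
  have hδ0 : 0 < δ := by positivity
  obtain ⟨F, hF, hFm⟩ := count_lattice K (fun i => A * g / σ i)
    (fun i => div_pos (by positivity) (hσpos i))
    (fun i => by
      rw [div_le_one (hσpos i)]
      exact hgJ.trans (hσanti (by have := i.2; omega)))
  have hcard : F.card ≤ n := by
    have : ∏ i : Fin K, (A / (A * g / σ i)) = n := by
      have h1 : ∀ i : Fin K, A / (A * g / σ i) = σ i / g := by
        intro i; have := hσpos i; field_simp
      simp only [h1]
      rw [Finset.prod_div_distrib, ← Finset.prod_range, Finset.prod_const, Finset.card_univ,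
        Fintype.card_fin, hgK, ← hPi]
      field_simp
    rw [this] at hF
    exact_mod_cast hF
  classical
  refine ⟨F.image fun m => hd q K (fun j => if h : j < K then δ * m ⟨j, h⟩ else 0),
    Finset.card_image_le.trans hcard, ?_⟩
  intro x hx
  choose m hm1 hm2 using fun i : Fin K => exists_trunc (σ i * x i / δ)
  refine ⟨_, Finset.mem_image_of_mem _ (hFm m ?_), ?_⟩
  · have h1 := lp_l1 p x K hK0
    rw [Finset.sum_range] at h1
    have h2 : ∀ i : Fin K, A * g / σ i * |(m i:ℝ)| ≤ (K:ℝ) ^ P * |x i| := by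
      intro i
      have h3 := hm1 i
      have h0 := hσpos i
      rw [abs_div, abs_mul, abs_of_pos h0, abs_of_pos hδ0] at h3
      calc _ ≤ A * g / σ i * (σ i * |x i| / δ) := by gcongr
        _ = _ := by
          rw [hδ, Real.rpow_neg hK'.le]
          field_simp
    calc _ ≤ ∑ i : Fin K, (K:ℝ) ^ P * |x i| := Finset.sum_le_sum fun i _ => h2 i
      _ = (K:ℝ) ^ P * ∑ i : Fin K, |x i| := by rw [Finset.mul_sum]
      _ ≤ (K:ℝ) ^ P * ((K:ℝ) ^ (1 - P) * 1) := by
        gcongr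
        exact h1.trans (by gcongr)
      _ = K := by
        rw [mul_one, ← Real.rpow_add hK']; simp
  · have h1 := lp_box q (hd q K (fun i => σ i * x i) -
      hd q K (fun j => if h : j < K then δ * m ⟨j, h⟩ else 0)) K hK0 δ hδ0.le ?_ ?_
    · refine h1.trans (le_of_eq ?_)
      change (K:ℝ) ^ Q * δ = _
      rw [hδ, hE, Real.rpow_add hK', Real.rpow_neg hK'.le]
      field_simp
    · intro i hi
      change |hd q K (fun i => σ i * x i) i -
        hd q K (fun j => if h : j < K then δ * m ⟨j, h⟩ else 0) i| ≤ δ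
      have h3 := hm2 ⟨i, hi⟩
      simp only [hd_apply, hi, if_true, dif_pos]
      have : σ i * x i - δ * m ⟨i, hi⟩ = δ * (σ i * x i / δ - m ⟨i, hi⟩) := by
        field_simp
      rw [this, abs_mul, abs_of_pos hδ0]
      exact mul_le_of_le_one_right hδ0.le h3
    · intro i hi
      change hd q K (fun i => σ i * x i) i -
        hd q K (fun j => if h : j < K then δ * m ⟨j, h⟩ else 0) i = 0
      simp [hd_apply, not_lt.2 hi]

/-- **Theorem 2, optimality under (ALP).**
Let `1 ≤ q < p ≤ ∞` with `1/q = 1/p + 1/r`, and let `σ` be a non-increasing sequence of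
positive reals tending to zero with `∑_k σ_k^r < ∞` (here `σ k` denotes the `(k+1)`-st
term `σ_{k+1}` of the paper, and `tailSeq r.toReal σ k` is the tail `τ_{k+1}`).  Assume
(ALP): `∃ c > 0, τ_n ≤ c σ_n n^{1/r}` for all `n ≥ 1`.  Then the entropy numbers of the
diagonal operator `D_σ : ℓ_p → ℓ_q` satisfy
`e_n(D_σ) ≍ sup_{k ≥ 1} k^{1/r} (σ_1⋯σ_k / n)^{1/k}`. -/
theorem statement3 (p q r : ℝ≥0∞) [Fact (1 ≤ p)] [Fact (1 ≤ q)]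
    (hqp : q < p) (hr : 1 / q = 1 / p + 1 / r)
    (σ : ℕ → ℝ) (hσpos : ∀ k, 0 < σ k) (hσanti : Antitone σ)
    (hσlim : Tendsto σ atTop (nhds 0))
    (hσsum : Summable (fun k : ℕ => σ k ^ r.toReal))
    (hALP : ∃ c : ℝ, 0 < c ∧ ∀ k : ℕ,
        tailSeq r.toReal σ k ≤ c * σ k * (k + 1 : ℝ) ^ (1 / r.toReal))
    (D : lp (fun _ : ℕ => ℝ) p →L[ℝ] lp (fun _ : ℕ => ℝ) q)
    (hD : ∀ (x : lp (fun _ : ℕ => ℝ) p) (k : ℕ), D x k = σ k * x k) :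
    ∃ c₁ c₂ : ℝ, 0 < c₁ ∧ 0 < c₂ ∧ ∀ n : ℕ, 1 ≤ n →
      c₁ * (⨆ k : ℕ, (k + 1 : ℝ) ^ (1 / r.toReal) *
          ((∏ i ∈ Finset.range (k + 1), σ i) / n) ^ (1 / (k + 1 : ℝ))) ≤
        entropyNumber n (D '' Metric.closedBall 0 1) ∧
      entropyNumber n (D '' Metric.closedBall 0 1) ≤
        c₂ * ⨆ k : ℕ, (k + 1 : ℝ) ^ (1 / r.toReal) *
          ((∏ i ∈ Finset.range (k + 1), σ i) / n) ^ (1 / (k + 1 : ℝ)) := by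
  obtain ⟨c, hc, hA⟩ := hALP
  have hA0 : (0:ℝ) < 4 * Real.exp 1 := by positivity
  refine ⟨(Real.exp 1)⁻¹, 4 * Real.exp 1 * (1 + c), by positivity, by positivity, ?_⟩
  intro n hn
  have hn' : (0:ℝ) < n := by exact_mod_cast hn
  set f : ℕ → ℝ := fun k => (k + 1 : ℝ) ^ (1 / r.toReal) *
          ((∏ i ∈ Finset.range (k + 1), σ i) / n) ^ (1 / (k + 1 : ℝ)) with hf
  have hfpos : ∀ k, 0 < f k := by
    intro k
    have : 0 < ∏ i ∈ Finset.range (k+1), σ i := Finset.prod_pos fun i _ => hσpos i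
    simp only [hf]
    positivity
  have hlow : ∀ ε ∈ {ε : ℝ | 0 < ε ∧ ∃ y : Fin n → lp (fun _ : ℕ => ℝ) q,
      D '' Metric.closedBall 0 1 ⊆ ⋃ i, Metric.closedBall (y i) ε},
      ∀ k, f k ≤ Real.exp 1 * ε := by
    rintro ε ⟨hε, y, hy⟩ k
    have := lower_aux p q r hqp hr σ hσpos D hD n hn (k+1) k.succ_pos ε hε y hy
    simpa [hf] using this
  have hne : (‖D‖ + 1) ∈ {ε : ℝ | 0 < ε ∧ ∃ y : Fin n → lp (fun _ : ℕ => ℝ) q,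
      D '' Metric.closedBall 0 1 ⊆ ⋃ i, Metric.closedBall (y i) ε} := by
    refine ⟨by positivity, fun _ => 0, ?_⟩
    rintro _ ⟨x, hx, rfl⟩
    rw [Set.mem_iUnion]
    refine ⟨⟨0, hn⟩, ?_⟩
    rw [mem_closedBall_zero_iff] at hx ⊢
    have := D.le_opNorm_of_le hx
    linarith
  have hbdd : BddAbove (Set.range f) := by
    refine ⟨Real.exp 1 * (‖D‖ + 1), ?_⟩
    rintro _ ⟨k, rfl⟩
    exact hlow _ hne k
  have hfS : ∀ k, f k ≤ ⨆ k, f k := fun k => le_ciSup hbdd k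
  have hS : 0 < ⨆ k, f k := (hfpos 0).trans_le (hfS 0)
  constructor
  · refine le_csInf ⟨_, hne⟩ ?_
    intro ε hε
    rw [inv_mul_le_iff₀ (Real.exp_pos 1)]
    exact ciSup_le (hlow ε hε)
  · set A := 4 * Real.exp 1 with hAdef
    have hA1 : 1 < A := by
      have := Real.add_one_le_exp (1:ℝ)
      rw [hAdef]; linarith
    have hex : ∃ K : ℕ, n * σ K ^ (K + 1) < A ^ (K + 1) * ∏ i ∈ Finset.range (K + 1), σ i := by
      obtain ⟨K, hK⟩ := pow_unbounded_of_one_lt (n:ℝ) hA1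
      refine ⟨K, ?_⟩
      have h1 : σ K ^ (K + 1) ≤ ∏ i ∈ Finset.range (K + 1), σ i := by
        have := Finset.prod_le_prod (s := Finset.range (K+1)) (f := fun _ => σ K) (g := σ)
          (fun i _ => (hσpos K).le)
          (fun i hi => hσanti (by have := Finset.mem_range.1 hi; omega))
        simpa using this
      have h2 : (n:ℝ) < A ^ (K + 1) := hK.trans_le (pow_le_pow_right₀ hA1.le (Nat.le_succ K))
      have h3 : 0 < σ K ^ (K + 1) := pow_pos (hσpos K) _
      calc _ < A ^ (K + 1) * σ K ^ (K + 1) := by gcongr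
        _ ≤ _ := by gcongr
    classical
    obtain ⟨K, hK, hmin⟩ : ∃ K : ℕ,
        n * σ K ^ (K + 1) < A ^ (K + 1) * (∏ i ∈ Finset.range (K + 1), σ i) ∧
        ∀ J < K, ¬ (n * σ J ^ (J + 1) < A ^ (J + 1) * ∏ i ∈ Finset.range (J + 1), σ i) :=
      ⟨Nat.find hex, Nat.find_spec hex, fun J hJ => Nat.find_min hex hJ⟩
    have htail : tailSeq r.toReal σ K ≤ c * A * ⨆ k, f k := by
      have hPi : 0 < ∏ i ∈ Finset.range (K + 1), σ i := Finset.prod_pos fun i _ => hσpos i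
      have h1 : σ K ≤ A * ((∏ i ∈ Finset.range (K + 1), σ i) / n) ^ (1 / (K + 1 : ℝ)) := by
        refine le_of_pow_le_pow_left₀ K.succ_ne_zero (by positivity) ?_
        have h2 : (((∏ i ∈ Finset.range (K + 1), σ i) / n) ^ (1 / (K + 1 : ℝ))) ^ (K + 1) =
            (∏ i ∈ Finset.range (K + 1), σ i) / n := by
          have := Real.rpow_inv_natCast_pow
            (x := (∏ i ∈ Finset.range (K + 1), σ i) / n) (by positivity) K.succ_ne_zero
          simpa using this
        rw [mul_pow, Nat.succ_eq_add_one, h2, ← mul_div_assoc, le_div_iff₀ hn']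
        linarith
      calc _ ≤ _ := hA K
        _ ≤ c * (A * ((∏ i ∈ Finset.range (K + 1), σ i) / n) ^ (1 / (K + 1 : ℝ))) *
            (K + 1 : ℝ) ^ (1 / r.toReal) := by gcongr
        _ = c * A * f K := by simp only [hf]; ring
        _ ≤ _ := by gcongr; exact hfS K
    obtain ⟨F, hF, hFc⟩ : ∃ F : Finset (lp (fun _ : ℕ => ℝ) q), F.card ≤ n ∧
        ∀ x : lp (fun _ : ℕ => ℝ) p, ‖x‖ ≤ 1 →
        ∃ y ∈ F, ‖hd q K (fun i => σ i * x i) - y‖ ≤ A * ⨆ k, f k := by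
      rcases K with _ | J
      · refine ⟨{0}, by simpa using hn, fun x hx => ⟨0, by simp, ?_⟩⟩
        have : hd q 0 (fun i => σ i * x i) = 0 := by
          ext i; simp [hd_apply]
        rw [this, sub_zero, norm_zero]
        positivity
      · obtain ⟨F, hF, h⟩ := head_cover p q r hqp hr σ hσpos hσanti n hn J
          (not_lt.1 (hmin J (Nat.lt_succ_self J)))
        refine ⟨F, hF, fun x hx => ?_⟩
        obtain ⟨y, hy, hxy⟩ := h x hx
        exact ⟨y, hy, hxy.trans (mul_le_mul_of_nonneg_left (hfS J) hA0.le)⟩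
    refine ent_le n _ F hF _ (by positivity) ?_
    rintro _ ⟨x, hx, rfl⟩
    rw [mem_closedBall_zero_iff] at hx
    obtain ⟨y, hy, hxy⟩ := hFc x hx
    refine ⟨y, hy, ?_⟩
    have ht := tail_bound p q r hqp hr σ hσpos hσsum K x
      (D x - hd q K (fun i => σ i * x i)) hx (by
        intro i
        change D x i - hd q K (fun i => σ i * x i) i = _
        rw [hD, hd_apply]
        split_ifs <;> first | omega | simp)
    calc ‖D x - y‖ = ‖(hd q K (fun i => σ i * x i) - y) + (D x - hd q K (fun i => σ i * x i))‖ := by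
          congr 1; abel
      _ ≤ _ := norm_add_le _ _
      _ ≤ A * (⨆ k, f k) + c * A * ⨆ k, f k := add_le_add hxy (ht.trans htail)
      _ = _ := by ring
end

section
/- Let 1 ≤ q < p ≤ ∞ with 1/q = 1/p + 1/r, and let σ = (σ_k)_{k≥1} be a non-increasing sequence of positive real numbers with σ_k → 0 and ∑_{k≥1} σ_k^r < ∞, with tail sequence τ_k = (∑_{n≥k} σ_n^r)^{1/r}. Assume condition (AMP): there exists c > 0 such that τ_n ≥ c · σ_n · n^{1/r} for all n ≥ 1. Then there exist constants c₁, c₂ > 0 such that for all n ≥ 1, c₁ · τ_{⌊log₂(n)⌋ + 1} ≤ e_n(D_σ) ≤ c₂ · τ_{⌊log₂(n)⌋ + 1}, where e_n(D_σ) is the n-th entropy number of the diagonal operator D_σ : ℓ_p → ℓ_q. -/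
open Metric Filter
open scoped ENNReal

lemma aux_exp (x : ℝ) (h0 : 0 ≤ x) (h1 : x ≤ 1) : 1 + Real.exp (-x) ≤ 2 * Real.exp (-(x/4)) := by
  have h2 : Real.exp (-x) ≤ 1 - x/2 := by
    rw [Real.exp_neg]
    have h3 := Real.add_one_le_exp x
    calc (Real.exp x)⁻¹ ≤ (x+1)⁻¹ := inv_anti₀ (by linarith) h3
      _ ≤ 1 - x/2 := by
        rw [inv_le_iff_one_le_mul₀ (by linarith)]
        nlinarith
  have := Real.add_one_le_exp (-(x/4))
  linarith

lemma aux_sum (a : ℝ) (ha : 0 < a) (B : ℕ) :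
    ∑ i ∈ Finset.Icc (-(B:ℤ)) B, Real.exp (-(|(i:ℝ)| / a)) ≤ 1 + 2 * a * (1 - Real.exp (-(B / a))) := by
  induction B with
  | zero => simp
  | succ B ih =>
    have hset : Finset.Icc (-((B+1:ℕ):ℤ)) ((B+1:ℕ):ℤ) =
        insert (-((B+1:ℕ):ℤ)) (insert ((B+1:ℕ):ℤ) (Finset.Icc (-(B:ℤ)) B)) := by
      ext i; simp only [Finset.mem_Icc, Finset.mem_insert]; omega
    rw [hset, Finset.sum_insert, Finset.sum_insert]
    · have e1 : |(((-((B+1:ℕ):ℤ)) : ℤ) : ℝ)| = (B:ℝ) + 1 := by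
        push_cast; rw [abs_neg, abs_of_nonneg (by positivity)]
      have e2 : |((((B+1:ℕ):ℤ)) : ℝ)| = (B:ℝ) + 1 := by
        push_cast; rw [abs_of_nonneg (by positivity)]
      rw [e1, e2]
      have h3 : Real.exp (-((B:ℝ) / a)) = Real.exp (-(((B:ℝ)+1) / a)) * Real.exp (1/a) := by
        rw [← Real.exp_add]; congr 1; ring
      have h4 := Real.add_one_le_exp (1/a)
      have h5 := Real.exp_pos (-(((B:ℝ)+1) / a))
      have h6 : 1 + a ≤ a * Real.exp (1/a) := by
        have := mul_le_mul_of_nonneg_left h4 ha.le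
        have e : a * (1/a+1) = 1 + a := by field_simp
        linarith
      rw [h3] at ih
      push_cast
      nlinarith [mul_le_mul_of_nonneg_left h6 h5.le]
    · simp
    · simp only [Finset.mem_Icc, Finset.mem_insert]; omega

lemma aux_count (k : ℕ) (a : Fin k → ℝ) (ha : ∀ j, 0 < a j) (R : ℝ) (B : ℕ)
    (F : Finset (Fin k → ℤ)) (hF : ∀ i ∈ F, (∀ j, |i j| ≤ (B:ℤ)) ∧ ∑ j, |(i j : ℝ)| / a j ≤ R) :
    (F.card : ℝ) ≤ Real.exp R * ∏ j, (1 + 2 * a j) := by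
  classical
  have hsub : F ⊆ Fintype.piFinset (fun _ : Fin k => Finset.Icc (-(B:ℤ)) B) := by
    intro i hi
    rw [Fintype.mem_piFinset]
    intro j
    have := (hF i hi).1 j
    rw [abs_le] at this
    simpa using this
  calc (F.card : ℝ) = ∑ i ∈ F, (1:ℝ) := by simp
    _ ≤ ∑ i ∈ F, Real.exp R * ∏ j, Real.exp (-(|(i j:ℝ)| / a j)) := by
        apply Finset.sum_le_sum
        intro i hi
        rw [← Real.exp_sum, ← Real.exp_add, Finset.sum_neg_distrib]
        have := (hF i hi).2
        exact Real.one_le_exp (by linarith)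
    _ ≤ ∑ i ∈ Fintype.piFinset (fun _ : Fin k => Finset.Icc (-(B:ℤ)) B),
          Real.exp R * ∏ j, Real.exp (-(|(i j:ℝ)| / a j)) :=
        Finset.sum_le_sum_of_subset_of_nonneg hsub (fun i _ _ => by positivity)
    _ = Real.exp R * ∏ j, ∑ i ∈ Finset.Icc (-(B:ℤ)) B, Real.exp (-(|(i:ℝ)| / a j)) := by
        rw [← Finset.mul_sum,
          Finset.prod_univ_sum (fun _ : Fin k => Finset.Icc (-(B:ℤ)) B)
            (fun j (i:ℤ) => Real.exp (-(|(i:ℝ)| / a j)))]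
    _ ≤ _ := by
        apply mul_le_mul_of_nonneg_left _ (Real.exp_pos _).le
        apply Finset.prod_le_prod
        · intro j _; positivity
        · intro j _
          refine (aux_sum (a j) (ha j) B).trans ?_
          have := Real.exp_pos (-((B:ℝ) / a j))
          nlinarith [ha j]

lemma aux_code (S : Finset ℕ) (b : ℕ → ℝ) (N α : ℝ) (hN : 0 ≤ N) (hb : ∀ j ∈ S, 0 ≤ b j)
    (hNb : ∀ j ∈ S, N * b j ≤ 1) (A0 : Finset ℕ) (hA0 : A0 ⊆ S) (F : Finset (Finset ℕ))
    (hF : ∀ A ∈ F, A ⊆ S ∧ ∑ j ∈ symmDiff A A0, b j ≤ α) :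
    (F.card : ℝ) ≤ 2 ^ S.card * Real.exp (N * α - N * (∑ j ∈ S, b j) / 4) := by
  have h1 : (F.card : ℝ) ≤ ∑ A ∈ F, Real.exp (N * α) * ∏ j ∈ symmDiff A A0, Real.exp (-(N * b j)) := by
    rw [Finset.card_eq_sum_ones]; push_cast
    apply Finset.sum_le_sum
    intro A hA
    rw [← Real.exp_sum, ← Real.exp_add, Finset.sum_neg_distrib, ← Finset.mul_sum]
    have := mul_le_mul_of_nonneg_left (hF A hA).2 hN
    exact Real.one_le_exp (by linarith)
  refine h1.trans ?_
  rw [← Finset.mul_sum]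
  have h2 : ∑ A ∈ F, ∏ j ∈ symmDiff A A0, Real.exp (-(N * b j)) ≤
      ∑ A ∈ S.powerset, ∏ j ∈ A, Real.exp (-(N * b j)) := by
    rw [← Finset.sum_image (s := F) (g := fun A => symmDiff A A0)
      (f := fun A => ∏ j ∈ A, Real.exp (-(N * b j)))]
    · apply Finset.sum_le_sum_of_subset_of_nonneg
      · intro A hA
        rw [Finset.mem_image] at hA
        obtain ⟨C, hC, rfl⟩ := hA
        rw [Finset.mem_powerset]
        intro x hx
        rw [Finset.mem_symmDiff] at hx
        rcases hx with h | h
        · exact (hF C hC).1 h.1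
        · exact hA0 h.1
      · intros; positivity
    · intro A _ C _ h
      exact symmDiff_left_injective A0 h
  rw [← Finset.prod_one_add] at h2
  have h3 : ∏ j ∈ S, (1 + Real.exp (-(N * b j))) ≤ ∏ j ∈ S, (2 * Real.exp (-(N * b j / 4))) := by
    apply Finset.prod_le_prod
    · intros; positivity
    · intro j hj
      exact aux_exp _ (mul_nonneg hN (hb j hj)) (hNb j hj)
  rw [Finset.prod_mul_distrib, Finset.prod_const, ← Real.exp_sum] at h3
  calc _ ≤ Real.exp (N * α) * (2 ^ S.card * Real.exp (∑ j ∈ S, -(N * b j / 4))) :=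
        mul_le_mul_of_nonneg_left (h2.trans h3) (Real.exp_pos _).le
    _ = _ := by
      rw [mul_left_comm, ← Real.exp_add, Finset.sum_neg_distrib, ← Finset.sum_div, ← Finset.mul_sum,
        ← sub_eq_add_neg]

/-- Tail sums. -/
noncomputable def tl (a : ℕ → ℝ) (k : ℕ) : ℝ := ∑' j : ℕ, if k ≤ j then a j else 0

lemma tl_summable (a : ℕ → ℝ) (ha : ∀ j, 0 < a j) (hs : Summable a) (k : ℕ) :
    Summable (fun j => if k ≤ j then a j else 0) := by
  refine Summable.of_nonneg_of_le (fun j => ?_) (fun j => ?_) hs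
  · split_ifs <;> [exact (ha j).le; exact le_rfl]
  · split_ifs <;> [exact le_rfl; exact (ha j).le]

lemma tl_sum_le (a : ℕ → ℝ) (ha : ∀ j, 0 < a j) (hs : Summable a) (k : ℕ) (S : Finset ℕ)
    (hS : ∀ j ∈ S, k ≤ j) : ∑ j ∈ S, a j ≤ tl a k := by
  have := (tl_summable a ha hs k).sum_le_tsum S (fun j _ => by
    split_ifs <;> [exact (ha j).le; exact le_rfl])
  refine le_trans (le_of_eq ?_) this
  exact Finset.sum_congr rfl (fun j hj => by rw [if_pos (hS j hj)])

lemma tl_pos (a : ℕ → ℝ) (ha : ∀ j, 0 < a j) (hs : Summable a) (k : ℕ) : 0 < tl a k := by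
  have := tl_sum_le a ha hs k {k} (by simp)
  simp at this
  exact (ha k).trans_le this

lemma tl_succ (a : ℕ → ℝ) (ha : ∀ j, 0 < a j) (hs : Summable a) (k : ℕ) :
    tl a k = a k + tl a (k+1) := by
  unfold tl
  rw [(tl_summable a ha hs k).tsum_eq_add_tsum_ite k]
  simp only [le_refl, if_true]
  congr 1
  apply tsum_congr
  intro j
  split_ifs <;> first | rfl | omega

lemma tl_exists (a : ℕ → ℝ) (ha : ∀ j, 0 < a j) (hs : Summable a) (k : ℕ) :
    ∃ S : Finset ℕ, (∀ j ∈ S, k ≤ j) ∧ tl a k / 2 ≤ ∑ j ∈ S, a j := by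
  have h := (tl_summable a ha hs k).hasSum
  have hp := tl_pos a ha hs k
  have h2 := h.eventually (lt_mem_nhds (half_lt_self hp))
  obtain ⟨S, hS⟩ := h2.exists
  refine ⟨S.filter (fun j => k ≤ j), by simp, ?_⟩
  rw [Finset.sum_filter]
  exact hS.le

lemma tl_growth (a : ℕ → ℝ) (ha : ∀ j, 0 < a j) (hs : Summable a) (c : ℝ) (hc : 0 < c)
    (h : ∀ k : ℕ, c * (a k * (k+1)) ≤ tl a k) :
    ∃ E : ℕ, ∀ j k : ℕ, j ≤ k → tl a j ≤ (((k:ℝ)+1)/((j:ℝ)+1))^E * tl a k := by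
  obtain ⟨K, hK⟩ := exists_nat_gt (2 / c)
  have hg : ∀ k, 0 ≤ (k+1) * a k / tl a (k+1) := fun k =>
    div_nonneg (mul_nonneg (by positivity) (ha k).le) (tl_pos a ha hs _).le
  obtain ⟨E, hE⟩ := exists_nat_ge (2 / c + ∑ k ∈ Finset.range K, (k+1) * a k / tl a (k+1))
  have hstep : ∀ k : ℕ, (k+1) * a k ≤ E * tl a (k+1) := by
    intro k
    have hp := tl_pos a ha hs (k+1)
    rw [← div_le_iff₀ hp]
    by_cases hk : k < K
    · have := Finset.single_le_sum (f := fun k : ℕ => (k+1) * a k / tl a (k+1))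
        (fun i _ => hg i) (Finset.mem_range.2 hk)
      have h2 : 0 < 2 / c := by positivity
      linarith
    · have hs0 : 0 ≤ ∑ k ∈ Finset.range K, (k+1) * a k / tl a (k+1) :=
        Finset.sum_nonneg (fun i _ => hg i)
      refine le_trans ?_ (le_trans (le_add_of_nonneg_right hs0) hE)
      rw [div_le_div_iff₀ hp hc]
      have hk' : (K:ℝ) ≤ k := by exact_mod_cast not_lt.1 hk
      have h1 := h k
      have h2 := tl_succ a ha hs k
      have h3 : 2 < c * (k+1) := by
        have : 2 / c < k + 1 := by linarith
        rwa [div_lt_iff₀' hc] at this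
      nlinarith [ha k]
  refine ⟨E, ?_⟩
  have hmono : Monotone (fun k : ℕ => tl a k * ((k:ℝ)+1)^E) := by
    apply monotone_nat_of_le_succ
    intro k
    have hp := tl_pos a ha hs (k+1)
    have hk : (0:ℝ) < k + 1 := by positivity
    have h1 := one_add_mul_le_pow (a := 1 / ((k:ℝ)+1)) (by have : 0 < 1 / ((k:ℝ)+1) := by positivity
                                                           linarith) E
    have h2 : tl a k ≤ tl a (k+1) * (1 + E * (1 / ((k:ℝ)+1))) := by
      rw [tl_succ a ha hs k]
      have h3 : a k ≤ E * tl a (k+1) / (k+1) := by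
        rw [le_div_iff₀ hk]; linarith [hstep k]
      have e : tl a (k+1) * (1 + E * (1 / ((k:ℝ)+1))) = E * tl a (k+1) / (k+1) + tl a (k+1) := by
        field_simp; ring
      linarith
    calc tl a k * ((k:ℝ)+1)^E ≤ tl a (k+1) * (1 + 1/((k:ℝ)+1))^E * ((k:ℝ)+1)^E := by
          gcongr
          exact h2.trans (mul_le_mul_of_nonneg_left h1 hp.le)
      _ = tl a (k+1) * (((k+1:ℕ):ℝ)+1)^E := by
          rw [mul_assoc, ← mul_pow]; congr 2; push_cast; field_simp
  intro j k hjk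
  have := hmono hjk
  simp only at this
  rw [div_pow, div_mul_eq_mul_div, le_div_iff₀ (by positivity)]
  linarith

abbrev lpn (p : ℝ≥0∞) := lp (fun _ : ℕ => ℝ) p

lemma ball_b (p : ℝ≥0∞) [Fact (1 ≤ p)] (x : lpn p) (hx : ‖x‖ ≤ 1) :
    ∃ b : ℕ → ℝ, (∀ j, 0 ≤ b j) ∧ (∀ S : Finset ℕ, ∑ j ∈ S, b j ≤ 1) ∧
      ∀ j, |x j| ≤ b j ^ (1 / p.toReal) := by
  have h1 : (1 : ℝ≥0∞) ≤ p := Fact.out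
  by_cases hp : p = ⊤
  · subst hp
    refine ⟨fun _ => 0, fun _ => le_rfl, fun S => by simp, fun j => ?_⟩
    have := lp.norm_apply_le_norm (by simp) x j
    rw [Real.norm_eq_abs] at this
    simpa using this.trans hx
  · have hp0 : 0 < p.toReal := ENNReal.toReal_pos (by rintro rfl; simp at h1) hp
    refine ⟨fun j => |x j| ^ p.toReal, fun j => by positivity, fun S => ?_, fun j => ?_⟩
    · have := lp.sum_rpow_le_norm_rpow hp0 x S
      simp only [Real.norm_eq_abs] at this
      exact this.trans (Real.rpow_le_one (norm_nonneg _) hx hp0.le)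
    · rw [← Real.rpow_mul (abs_nonneg _), mul_one_div_cancel hp0.ne', Real.rpow_one]

lemma fin_mem (p : ℝ≥0∞) (S : Finset ℕ) (f : ℕ → ℝ) (hf : ∀ j, j ∉ S → f j = 0) :
    ∃ y : lpn p, ∀ j, y j = f j := by
  have h0 : Memℓp (E := fun _ : ℕ => ℝ) f 0 := by
    apply memℓp_zero
    apply S.finite_toSet.subset
    intro j hj
    by_contra h
    exact hj (hf j h)
  exact ⟨⟨f, h0.of_exponent_ge (zero_le)⟩, fun j => rfl⟩

lemma pt_ball (p : ℝ≥0∞) [Fact (1 ≤ p)] (S : Finset ℕ) (b : ℕ → ℝ) (hb : ∀ j, 0 ≤ b j)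
    (hS : ∑ j ∈ S, b j ≤ 1) (A : Finset ℕ) (hA : A ⊆ S) :
    ∃ x : lpn p, ‖x‖ ≤ 1 ∧ ∀ j, x j = if j ∈ A then b j ^ (1 / p.toReal) else 0 := by
  have h1 : (1 : ℝ≥0∞) ≤ p := Fact.out
  obtain ⟨x, hx⟩ := fin_mem p A (fun j => if j ∈ A then b j ^ (1 / p.toReal) else 0)
    (fun j hj => by simp [hj])
  refine ⟨x, ?_, hx⟩
  by_cases hp : p = ⊤
  · subst hp
    apply lp.norm_le_of_forall_le zero_le_one
    intro j
    rw [hx]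
    split_ifs <;> simp
  · have hp0 : 0 < p.toReal := ENNReal.toReal_pos (by rintro rfl; simp at h1) hp
    apply lp.norm_le_of_forall_sum_le hp0 zero_le_one
    intro t
    rw [Real.one_rpow]
    calc ∑ i ∈ t, ‖x i‖ ^ p.toReal ≤ ∑ i ∈ t, if i ∈ A then b i else 0 := by
          apply Finset.sum_le_sum
          intro i _
          rw [hx]
          split_ifs
          · rw [Real.norm_eq_abs, abs_of_nonneg (Real.rpow_nonneg (hb i) _),
              ← Real.rpow_mul (hb i), one_div_mul_cancel hp0.ne', Real.rpow_one]
          · simp [Real.zero_rpow hp0.ne']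
      _ = ∑ i ∈ t.filter (· ∈ A), b i := by rw [Finset.sum_filter]
      _ ≤ ∑ i ∈ S, b i := by
          apply Finset.sum_le_sum_of_subset_of_nonneg
          · intro i hi; exact hA (Finset.mem_filter.1 hi).2
          · intros; exact hb _
      _ ≤ 1 := hS

lemma enum_fin {ι Y : Type*} [Inhabited Y] (F : Finset ι) (n : ℕ) (h : F.card ≤ n) (g : ι → Y) :
    ∃ y : Fin n → Y, ∀ i ∈ F, ∃ t, y t = g i := by
  classical
  refine ⟨fun t => if h : t.1 < F.card then g (F.equivFin.symm ⟨t.1, h⟩).1 else default, ?_⟩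
  intro i hi
  refine ⟨⟨(F.equivFin ⟨i, hi⟩).1, lt_of_lt_of_le (F.equivFin ⟨i, hi⟩).2 h⟩, ?_⟩
  simp

lemma prod_ratio (k : ℕ) : ∏ j : Fin k, (((k:ℝ)+1)/((j:ℝ)+1)) ≤ Real.exp (2 * k) := by
  rw [Finset.prod_div_distrib, Finset.prod_const, Finset.card_univ, Fintype.card_fin]
  have e : ∏ j : Fin k, ((j:ℝ)+1) = (k.factorial : ℝ) := by
    rw [Fin.prod_univ_eq_prod_range (fun j : ℕ => (j:ℝ)+1) k,
      ← Finset.prod_range_add_one_eq_factorial]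
    push_cast; rfl
  rw [e]
  rcases Nat.eq_zero_or_pos k with rfl | hk
  · simp
  · refine (Real.pow_div_factorial_le_exp _ (by positivity) k).trans ?_
    apply Real.exp_le_exp.2
    have : (1:ℝ) ≤ k := by exact_mod_cast hk
    linarith

lemma grid_count (C0 : ℝ) (hC0 : 1 ≤ C0) (F : ℕ) : ∃ L : ℕ, 0 < L ∧ ∀ k : ℕ,
    Real.exp (4 * k) * ∏ j : Fin k, (1 + 2 * (C0 * (((k:ℝ)+1)/((j:ℝ)+1))^F)) ≤ 2^(L*k) := by
  obtain ⟨L, hL⟩ := pow_unbounded_of_one_lt (Real.exp 4 * (3 * C0) * Real.exp 2 ^ F) (one_lt_two)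
  refine ⟨L + 1, Nat.succ_pos _, fun k => ?_⟩
  have h1 : ∏ j : Fin k, (1 + 2 * (C0 * (((k:ℝ)+1)/((j:ℝ)+1))^F)) ≤
      ∏ j : Fin k, (3 * C0) * (((k:ℝ)+1)/((j:ℝ)+1))^F := by
    apply Finset.prod_le_prod
    · intros; positivity
    · intro j _
      have : 1 ≤ ((k:ℝ)+1)/((j:ℝ)+1) := by
        rw [one_le_div (by positivity)]
        have : (j:ℝ) ≤ k := by exact_mod_cast j.2.le
        linarith
      have := one_le_pow₀ this (n := F)
      nlinarith
  rw [Finset.prod_mul_distrib, Finset.prod_const, Finset.card_univ, Fintype.card_fin,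
    Finset.prod_pow] at h1
  have h0 : 0 ≤ ∏ j : Fin k, (((k:ℝ)+1)/((j:ℝ)+1)) := Finset.prod_nonneg (fun _ _ => by positivity)
  have h2 := pow_le_pow_left₀ h0 (prod_ratio k) F
  calc _ ≤ Real.exp (4 * k) * ((3 * C0)^k * Real.exp (2 * k) ^ F) := by
        apply mul_le_mul_of_nonneg_left _ (Real.exp_pos _).le
        exact h1.trans (mul_le_mul_of_nonneg_left h2 (by positivity))
    _ = (Real.exp 4 * (3 * C0) * Real.exp 2 ^ F)^k := by
        rw [mul_comm 4, mul_comm 2 (k:ℝ), Real.exp_nat_mul, Real.exp_nat_mul]; ring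
    _ ≤ (2^L)^k := by gcongr
    _ = 2^(L*k) := by rw [pow_mul]
    _ ≤ _ := by
        apply pow_le_pow_right₀ one_le_two
        gcongr; omega

lemma rpow_le_one_add (u s : ℝ) (hu : 0 ≤ u) (hs : 0 ≤ s) (hs1 : s ≤ 1) : u ^ s ≤ 1 + u := by
  rcases le_total u 1 with h | h
  · linarith [Real.rpow_le_one hu h hs]
  · have := Real.rpow_le_rpow_of_exponent_le h hs1
    rw [Real.rpow_one] at this; linarith

lemma coef_bound (q r s c Tj Tk σj ρ x y : ℝ) (E F : ℕ) (hr : 0 < r)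
    (hs : 1 / q = s + 1 / r) (hc : 0 < c)
    (hTj : 0 < Tj) (hTk : 0 < Tk) (hx : 0 < x) (hρ : 1 ≤ ρ) (hy : y = ρ * x)
    (hF : ((E:ℝ) + 1) / r ≤ F) (h1 : c * (σj * x ^ (1 / r)) ≤ Tj ^ (1 / r))
    (h2 : Tj ≤ ρ ^ E * Tk) :
    σj * y ^ (1/q) ≤ (max 1 (1/c) * ρ ^ F) * y ^ s * Tk ^ (1/r) := by
  have hρ0 : 0 < ρ := by linarith
  have hy0 : 0 < y := by rw [hy]; positivity
  have e1 : y ^ (1/q) = y ^ s * (ρ ^ (1/r) * x ^ (1/r)) := by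
    rw [hs, Real.rpow_add hy0, ← Real.mul_rpow hρ0.le hx.le, ← hy]
  have h3 : Tj ^ (1/r) ≤ ρ ^ ((E:ℝ)/r) * Tk ^ (1/r) := by
    calc Tj ^ (1/r) ≤ (ρ ^ E * Tk) ^ (1/r) := Real.rpow_le_rpow hTj.le h2 (by positivity)
      _ = _ := by
        rw [Real.mul_rpow (by positivity) hTk.le, ← Real.rpow_natCast, ← Real.rpow_mul hρ0.le]
        congr 2; ring
  have h4 : σj * x ^ (1/r) ≤ 1/c * (ρ ^ ((E:ℝ)/r) * Tk ^ (1/r)) := by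
    rw [one_div_mul_eq_div, le_div_iff₀ hc]; linarith
  have h5 : ρ ^ (1/r) * ρ ^ ((E:ℝ)/r) ≤ ρ ^ F := by
    rw [← Real.rpow_add hρ0, ← Real.rpow_natCast]
    apply Real.rpow_le_rpow_of_exponent_le hρ
    refine le_trans (le_of_eq ?_) hF; ring
  calc σj * y ^ (1/q) = (σj * x ^ (1/r)) * (y ^ s * ρ ^ (1/r)) := by rw [e1]; ring
    _ ≤ (1/c * (ρ ^ ((E:ℝ)/r) * Tk ^ (1/r))) * (y ^ s * ρ ^ (1/r)) := by gcongr
    _ = 1/c * (ρ ^ (1/r) * ρ ^ ((E:ℝ)/r)) * (y ^ s * Tk ^ (1/r)) := by ring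
    _ ≤ max 1 (1/c) * ρ ^ F * (y ^ s * Tk ^ (1/r)) := by
        gcongr; exact le_max_right _ _
    _ = _ := by ring

lemma tail_pt (q r s T σj b x : ℝ) (hq : 1 ≤ q) (hr : 0 < r) (hs0 : 0 ≤ s)
    (hs : 1 / q = s + 1 / r) (hT : 0 < T) (hσ : 0 < σj) (hb : 0 ≤ b) (hx : |x| ≤ b ^ s) :
    |σj * x| ^ q ≤ (T ^ (1/r)) ^ q * (q / r * (σj ^ r / T) + s * q * b) := by
  have hq0 : 0 < q := by linarith
  have hw : q / r + s * q = 1 := by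
    have : q * (1/q) = q * (s + 1/r) := by rw [hs]
    rw [mul_one_div_cancel hq0.ne'] at this
    rw [this]; ring
  have h1 := Real.geom_mean_le_arith_mean2_weighted (w₁ := q/r) (w₂ := s*q) (p₁ := σj ^ r / T)
    (p₂ := b) (by positivity) (by positivity) (by positivity) hb hw
  calc |σj * x| ^ q ≤ (σj * b ^ s) ^ q := by
        apply Real.rpow_le_rpow (abs_nonneg _) _ hq0.le
        rw [abs_mul, abs_of_pos hσ]
        exact mul_le_mul_of_nonneg_left hx hσ.le
    _ = (T ^ (1/r)) ^ q * ((σj ^ r / T) ^ (q/r) * b ^ (s*q)) := by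
        rw [Real.mul_rpow hσ.le (by positivity), ← Real.rpow_mul hb, Real.div_rpow (by positivity) hT.le,
          ← Real.rpow_mul hσ.le, ← Real.rpow_mul hT.le]
        have e1 : r * (q/r) = q := by field_simp
        have e2 : 1/r*q = q/r := by ring
        rw [e1, e2]
        have : 0 < T ^ (q/r) := by positivity
        field_simp
    _ ≤ _ := mul_le_mul_of_nonneg_left h1 (by positivity)

lemma upper_cover (p Q : ℝ≥0∞) [Fact (1 ≤ p)] [Fact (1 ≤ Q)] (q r s : ℝ) (hqQ : Q.toReal = q)
    (hsp : 1 / p.toReal = s) (hq : 1 ≤ q) (hr : 0 < r) (hs0 : 0 ≤ s) (hs1 : s ≤ 1)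
    (hs : 1 / q = s + 1 / r) (σ : ℕ → ℝ) (hσ : ∀ k, 0 < σ k)
    (hsum : Summable (fun k : ℕ => σ k ^ r)) (c : ℝ) (hc : 0 < c)
    (hA : ∀ k : ℕ, c * (σ k * (k + 1 : ℝ) ^ (1 / r)) ≤ tl (fun k => σ k ^ r) k ^ (1 / r))
    (E : ℕ) (hE : ∀ j k : ℕ, j ≤ k →
      tl (fun k => σ k ^ r) j ≤ (((k:ℝ)+1)/((j:ℝ)+1))^E * tl (fun k => σ k ^ r) k)
    (D : lpn p →L[ℝ] lpn Q) (hD : ∀ (x : lpn p) (k : ℕ), D x k = σ k * x k) :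
    ∃ L : ℕ, 0 < L ∧ ∀ k n : ℕ, 2 ^ (L * k) ≤ n → ∃ y : Fin n → lpn Q,
      D '' Metric.closedBall 0 1 ⊆
        ⋃ i, Metric.closedBall (y i) (2 * tl (fun k => σ k ^ r) k ^ (1 / r)) := by
  have hq0 : 0 < q := by linarith
  have ha : ∀ j, 0 < σ j ^ r := fun j => Real.rpow_pos_of_pos (hσ j) _
  obtain ⟨F, hF⟩ := exists_nat_ge (((E:ℝ) + 1) / r)
  set C0 := max 1 (1/c) with hC0
  have hC1 : 1 ≤ C0 := le_max_left _ _
  obtain ⟨L, hL, hcount⟩ := grid_count C0 hC1 F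
  refine ⟨L, hL, fun k n hkn => ?_⟩
  set T := tl (fun k => σ k ^ r) k with hT
  have hTpos : 0 < T := tl_pos _ ha hsum k
  set τ := T ^ (1/r) with hτ
  have hτpos : 0 < τ := Real.rpow_pos_of_pos hTpos _
  set h := τ / ((k:ℝ)+1) ^ (1/q) with hh
  have hk1 : (0:ℝ) < (k:ℝ) + 1 := by positivity
  have hpos : 0 < h := by positivity
  set a : Fin k → ℝ := fun j => C0 * (((k:ℝ)+1)/((j:ℝ)+1))^F with hadef
  have hρ : ∀ j : Fin k, 1 ≤ ((k:ℝ)+1)/((j:ℝ)+1) := by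
    intro j
    rw [one_le_div (by positivity)]
    have : (j:ℝ) ≤ k := by exact_mod_cast j.2.le
    linarith
  have ha1 : ∀ j, 1 ≤ a j := fun j => one_le_mul_of_one_le_of_one_le hC1 (one_le_pow₀ (hρ j))
  obtain ⟨B, hB⟩ := exists_nat_ge (∑ j, 4 * k * a j)
  set G : Finset (Fin k → ℤ) := (Fintype.piFinset (fun _ : Fin k => Finset.Icc (-(B:ℤ)) B)).filter
    (fun i => ∑ j, |(i j : ℝ)| / a j ≤ 4 * k) with hG
  have hGcard : G.card ≤ n := by
    have h1 := aux_count k a (fun j => by linarith [ha1 j]) (4 * k) B G (by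
      intro i hi
      rw [hG, Finset.mem_filter, Fintype.mem_piFinset] at hi
      refine ⟨fun j => ?_, hi.2⟩
      rw [abs_le]; simpa using hi.1 j)
    have h2 := h1.trans (hcount k)
    have h3 : G.card ≤ 2 ^ (L * k) := by exact_mod_cast h2
    exact h3.trans hkn
  have hcen : ∀ i : Fin k → ℤ, ∃ y : lpn Q, ∀ j, y j = if hj : j < k then h * (i ⟨j, hj⟩ : ℝ) else 0 :=
    fun i => fin_mem Q (Finset.range k) _ (fun j hj => by
      rw [Finset.mem_range] at hj; simp [hj])
  choose g hg using hcen
  haveI : Inhabited (lpn Q) := ⟨0⟩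
  obtain ⟨y, hy⟩ := enum_fin G n hGcard g
  refine ⟨y, ?_⟩
  rintro _ ⟨x, hx, rfl⟩
  rw [mem_closedBall_zero_iff] at hx
  obtain ⟨b, hb0, hbS, hxb⟩ := ball_b p x hx
  rw [hsp] at hxb
  set z : Fin k → ℝ := fun j => σ j * x j / h with hz
  have hzb : ∀ j : Fin k, |z j| ≤ a j * (1 + (k+1) * b j) := by
    intro j
    have h1 := coef_bound q r s c _ T (σ j) (((k:ℝ)+1)/((j:ℝ)+1)) ((j:ℝ)+1) ((k:ℝ)+1) E F hr hs hc
      (tl_pos _ ha hsum j) hTpos (by positivity) (hρ j) (by field_simp) hF (hA j) (hE j k j.2.le)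
    have h2 : σ j / h ≤ a j * ((k:ℝ)+1) ^ s := by
      rw [hh, div_div_eq_mul_div, div_le_iff₀ hτpos]
      exact h1
    have h3 := rpow_le_one_add (((k:ℝ)+1) * b j) s (mul_nonneg hk1.le (hb0 j)) hs0 hs1
    rw [Real.mul_rpow hk1.le (hb0 j)] at h3
    have h4 : |z j| = σ j / h * |x j| := by
      simp only [hz]
      rw [abs_div, abs_mul, abs_of_pos (hσ j), abs_of_pos hpos]; ring
    have haj := ha1 j
    rw [h4]
    calc σ j / h * |x j| ≤ (a j * ((k:ℝ)+1) ^ s) * b j ^ s := by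
          apply mul_le_mul h2 (hxb j) (abs_nonneg _) (by positivity)
      _ = a j * (((k:ℝ)+1) ^ s * b j ^ s) := by ring
      _ ≤ _ := mul_le_mul_of_nonneg_left h3 (by linarith)
  have hround : ∀ j, |((round (z j) : ℤ) : ℝ)| / a j ≤ 2 + (k+1) * b j := by
    intro j
    have haj := ha1 j
    rw [div_le_iff₀ (by linarith)]
    have h1 := abs_sub_round (z j)
    have h2 : |((round (z j) : ℤ) : ℝ)| ≤ |z j| + 1/2 := by
      have := abs_sub_abs_le_abs_sub ((round (z j) : ℤ) : ℝ) (z j)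
      rw [abs_sub_comm] at this
      linarith
    nlinarith [hzb j]
  have hsumr : ∑ j, |((round (z j) : ℤ) : ℝ)| / a j ≤ 4 * k := by
    rcases Nat.eq_zero_or_pos k with hk | hk
    · subst hk; simp
    · calc _ ≤ ∑ j : Fin k, (2 + ((k:ℝ)+1) * b j) := Finset.sum_le_sum (fun j _ => hround j)
        _ = 2 * k + (k+1) * ∑ j : Fin k, b j := by
          rw [Finset.sum_add_distrib, ← Finset.mul_sum]; simp; ring
        _ ≤ 2 * k + (k+1) * 1 := by
          have := hbS (Finset.range k)
          rw [← Fin.sum_univ_eq_sum_range (fun j => b j) k] at this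
          gcongr
        _ ≤ 4 * k := by
          have : (1:ℝ) ≤ k := by exact_mod_cast hk
          linarith
  have hmem : (fun j => round (z j)) ∈ G := by
    rw [hG, Finset.mem_filter, Fintype.mem_piFinset]
    refine ⟨fun j => ?_, hsumr⟩
    have haj := ha1 j
    have h1 : |((round (z j) : ℤ) : ℝ)| / a j ≤ 4 * k := by
      refine le_trans ?_ hsumr
      exact Finset.single_le_sum (f := fun j => |((round (z j) : ℤ) : ℝ)| / a j)
        (fun i _ => div_nonneg (abs_nonneg _) (by linarith [ha1 i])) (Finset.mem_univ j)
    rw [div_le_iff₀ (by linarith)] at h1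
    have h2 : 4 * k * a j ≤ ∑ j, 4 * k * a j :=
      Finset.single_le_sum (f := fun j => 4 * k * a j)
        (fun i _ => mul_nonneg (by positivity) (by linarith [ha1 i])) (Finset.mem_univ j)
    have h3 : |((round (z j) : ℤ) : ℝ)| ≤ (B:ℝ) := by linarith
    have h4 : |round (z j)| ≤ (B:ℤ) := by exact_mod_cast h3
    rw [abs_le] at h4
    simpa using h4
  obtain ⟨t, ht⟩ := hy _ hmem
  refine Set.mem_iUnion.2 ⟨t, ?_⟩
  rw [mem_closedBall_iff_norm, ht]
  apply lp.norm_le_of_forall_sum_le (by rw [hqQ]; exact hq0) (by positivity)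
  intro S
  rw [hqQ]
  have hcoord : ∀ j, (D x - g (fun j => round (z j))) j =
      σ j * x j - (if hj : j < k then h * (round (z ⟨j, hj⟩) : ℝ) else 0) := by
    intro j
    rw [lp.coeFn_sub, Pi.sub_apply, hD, hg]
  simp only [hcoord, Real.norm_eq_abs]
  rw [← Finset.sum_filter_add_sum_filter_not S (fun j => j < k)]
  have hhead : ∑ j ∈ S.filter (fun j => j < k),
      |σ j * x j - (if hj : j < k then h * (round (z ⟨j, hj⟩) : ℝ) else 0)| ^ q ≤ τ ^ q := by
    calc _ ≤ ∑ j ∈ S.filter (fun j => j < k), τ ^ q / (k+1) := by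
          apply Finset.sum_le_sum
          intro j hj
          rw [Finset.mem_filter] at hj
          rw [dif_pos hj.2]
          have h1 := abs_sub_round (z ⟨j, hj.2⟩)
          have e : σ j * x j - h * (round (z ⟨j, hj.2⟩) : ℝ) = h * (z ⟨j, hj.2⟩ - round (z ⟨j, hj.2⟩)) := by
            rw [mul_sub]; congr 1; simp only [hz]; field_simp
          have h2 : |σ j * x j - h * (round (z ⟨j, hj.2⟩) : ℝ)| ≤ h := by
            rw [e, abs_mul, abs_of_pos hpos]; nlinarith
          refine (Real.rpow_le_rpow (abs_nonneg _) h2 hq0.le).trans (le_of_eq ?_)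
          rw [hh, Real.div_rpow hτpos.le (by positivity), ← Real.rpow_mul hk1.le,
            one_div_mul_cancel hq0.ne', Real.rpow_one]
      _ ≤ ∑ j ∈ Finset.range k, τ ^ q / (k+1) := by
          apply Finset.sum_le_sum_of_subset_of_nonneg
          · intro j hj; rw [Finset.mem_filter] at hj; exact Finset.mem_range.2 hj.2
          · intros; positivity
      _ = τ ^ q * (k / (k+1)) := by rw [Finset.sum_const, Finset.card_range, nsmul_eq_mul]; ring
      _ ≤ τ ^ q * 1 := by
          gcongr
          rw [div_le_one hk1]; linarith
      _ = _ := mul_one _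
  have htail : ∑ j ∈ S.filter (fun j => ¬ j < k),
      |σ j * x j - (if hj : j < k then h * (round (z ⟨j, hj⟩) : ℝ) else 0)| ^ q ≤ τ ^ q := by
    have hw : q / r + s * q = 1 := by
      have : q * (1/q) = q * (s + 1/r) := by rw [hs]
      rw [mul_one_div_cancel hq0.ne'] at this
      rw [this]; ring
    calc _ ≤ ∑ j ∈ S.filter (fun j => ¬ j < k), τ ^ q * (q / r * (σ j ^ r / T) + s * q * b j) := by
          apply Finset.sum_le_sum
          intro j hj
          rw [Finset.mem_filter] at hj
          rw [dif_neg hj.2, sub_zero]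
          exact tail_pt q r s T (σ j) (b j) (x j) hq hr hs0 hs hTpos (hσ j) (hb0 j) (hxb j)
      _ = τ ^ q * (q / r * ((∑ j ∈ S.filter (fun j => ¬ j < k), σ j ^ r) / T) +
            s * q * ∑ j ∈ S.filter (fun j => ¬ j < k), b j) := by
          rw [← Finset.mul_sum, Finset.sum_add_distrib, ← Finset.mul_sum, ← Finset.mul_sum,
            Finset.sum_div]
      _ ≤ τ ^ q * (q / r * 1 + s * q * 1) := by
          have h1 := tl_sum_le _ ha hsum k (S.filter (fun j => ¬ j < k)) (by
            intro j hj; rw [Finset.mem_filter] at hj; exact not_lt.1 hj.2)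
          have h2 := hbS (S.filter (fun j => ¬ j < k))
          gcongr
          rw [div_le_one hTpos]; exact h1
      _ = τ ^ q := by rw [mul_one, mul_one, hw, mul_one]
  have h2q : (2:ℝ) ≤ 2 ^ q := by
    simpa using Real.rpow_le_rpow_of_exponent_le (one_le_two : (1:ℝ) ≤ 2) hq
  rw [Real.mul_rpow zero_le_two hτpos.le]
  have : 0 < τ ^ q := by positivity
  nlinarith

lemma lower_bd (p Q : ℝ≥0∞) [Fact (1 ≤ p)] [Fact (1 ≤ Q)] (q r s : ℝ) (hqQ : Q.toReal = q)
    (hsp : 1 / p.toReal = s) (hq : 1 ≤ q) (hr : 0 < r)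
    (hs : 1 / q = s + 1 / r) (σ : ℕ → ℝ) (hσ : ∀ k, 0 < σ k) (hanti : Antitone σ)
    (hsum : Summable (fun k : ℕ => σ k ^ r)) (c : ℝ) (hc : 0 < c)
    (hA : ∀ k : ℕ, c * (σ k ^ r * (k + 1 : ℝ)) ≤ tl (fun k => σ k ^ r) k)
    (D : lpn p →L[ℝ] lpn Q) (hD : ∀ (x : lpn p) (k : ℕ), D x k = σ k * x k)
    (n M : ℕ) (hnM : (n:ℝ) < Real.exp (c * (M+1) / 16)) (ε : ℝ) (y : Fin n → lpn Q)
    (hy : D '' Metric.closedBall 0 1 ⊆ ⋃ i, Metric.closedBall (y i) ε) :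
    tl (fun k => σ k ^ r) M ^ (1/r) / 32 ≤ ε := by
  classical
  have hq0 : 0 < q := by linarith
  have ha : ∀ j, 0 < σ j ^ r := fun j => Real.rpow_pos_of_pos (hσ j) _
  set T := tl (fun k => σ k ^ r) M with hT
  have hTpos : 0 < T := tl_pos _ ha hsum M
  set τ := T ^ (1/r) with hτ
  have hτpos : 0 < τ := Real.rpow_pos_of_pos hTpos _
  by_contra hcon
  push Not at hcon
  obtain ⟨S, hSM, hShalf⟩ := tl_exists _ ha hsum M
  have hStot := tl_sum_le _ ha hsum M S hSM
  set b : ℕ → ℝ := fun j => σ j ^ r / T with hb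
  have hb0 : ∀ j, 0 ≤ b j := fun j => (div_pos (ha j) hTpos).le
  have hbS : ∑ j ∈ S, b j ≤ 1 := by
    simp only [hb]; rw [← Finset.sum_div, div_le_one hTpos]; exact hStot
  have hbhalf : 1/2 ≤ ∑ j ∈ S, b j := by
    simp only [hb]; rw [← Finset.sum_div, le_div_iff₀ hTpos]; linarith
  set N := c * ((M:ℝ)+1) with hN
  have hN0 : 0 < N := by positivity
  have hNb : ∀ j ∈ S, N * b j ≤ 1 := by
    intro j hj
    simp only [hb]
    rw [← mul_div_assoc, div_le_one hTpos]
    refine le_trans ?_ (hA M)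
    have : σ j ^ r ≤ σ M ^ r := Real.rpow_le_rpow (hσ j).le (hanti (hSM j hj)) hr.le
    calc N * σ j ^ r ≤ N * σ M ^ r := by gcongr
      _ = _ := by rw [hN]; ring
  have hpt : ∀ A : Finset ℕ, ∃ x : lpn p, A ⊆ S →
      (‖x‖ ≤ 1 ∧ ∀ j, x j = if j ∈ A then b j ^ s else 0) := by
    intro A
    by_cases hAS : A ⊆ S
    · obtain ⟨x, hx⟩ := pt_ball p S b hb0 hbS A hAS
      rw [hsp] at hx
      exact ⟨x, fun _ => hx⟩
    · exact ⟨0, fun h => absurd h hAS⟩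
  choose X hX using hpt
  have hfind : ∀ A : Finset ℕ, A ⊆ S → ∃ i, ‖D (X A) - y i‖ ≤ ε := by
    intro A hAS
    have := hy ⟨X A, by rw [mem_closedBall_zero_iff]; exact (hX A hAS).1, rfl⟩
    obtain ⟨i, hi⟩ := Set.mem_iUnion.1 this
    exact ⟨i, mem_closedBall_iff_norm.1 hi⟩
  have hsep : ∀ A C : Finset ℕ, A ⊆ S → C ⊆ S → τ ^ q * ∑ j ∈ symmDiff A C, b j ≤
      ‖D (X A) - D (X C)‖ ^ q := by
    intro A C hAS hCS
    have h1 := lp.sum_rpow_le_norm_rpow (by rw [hqQ]; exact hq0) (D (X A) - D (X C)) (symmDiff A C)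
    rw [hqQ] at h1
    refine le_trans (le_of_eq ?_) h1
    rw [Finset.mul_sum]
    apply Finset.sum_congr rfl
    intro j hj
    rw [lp.coeFn_sub, Pi.sub_apply, hD, hD, (hX A hAS).2, (hX C hCS).2]
    have e : ‖σ j * (if j ∈ A then b j ^ s else 0) - σ j * (if j ∈ C then b j ^ s else 0)‖ = σ j * b j ^ s := by
      have hnn : 0 ≤ σ j * b j ^ s := mul_nonneg (hσ j).le (Real.rpow_nonneg (hb0 j) _)
      rw [Finset.mem_symmDiff] at hj
      rcases hj with h | h
      · rw [if_pos h.1, if_neg h.2, mul_zero, sub_zero, Real.norm_eq_abs, abs_of_nonneg hnn]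
      · rw [if_pos h.1, if_neg h.2, mul_zero, zero_sub, norm_neg, Real.norm_eq_abs, abs_of_nonneg hnn]
    rw [e]
    have hbp : 0 < b j := div_pos (ha j) hTpos
    have e2 : σ j = τ * b j ^ (1/r) := by
      simp only [hb]
      rw [hτ, Real.div_rpow (ha j).le hTpos.le, ← Real.rpow_mul (hσ j).le, mul_one_div_cancel hr.ne',
        Real.rpow_one]
      field_simp
    rw [e2, mul_assoc, ← Real.rpow_add hbp, add_comm (1/r) s, ← hs, Real.mul_rpow hτpos.le (by positivity),
      ← Real.rpow_mul hbp.le, one_div_mul_cancel hq0.ne', Real.rpow_one]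
  have hclose : ∀ A C : Finset ℕ, A ⊆ S → C ⊆ S → ∀ i, ‖D (X A) - y i‖ ≤ ε → ‖D (X C) - y i‖ ≤ ε →
      ∑ j ∈ symmDiff A C, b j ≤ 1/16 := by
    intro A C hAS hCS i h1 h2
    have h3 : ‖D (X A) - D (X C)‖ ≤ τ / 16 := by
      have := norm_sub_le (D (X A) - y i) (D (X C) - y i)
      rw [sub_sub_sub_cancel_right] at this
      linarith
    have h4 := (hsep A C hAS hCS).trans (Real.rpow_le_rpow (norm_nonneg _) h3 hq0.le)
    rw [Real.div_rpow hτpos.le (by norm_num), div_eq_mul_one_div] at h4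
    have h5 := le_of_mul_le_mul_left h4 (by positivity)
    refine h5.trans ?_
    apply one_div_le_one_div_of_le (by norm_num)
    simpa using Real.rpow_le_rpow_of_exponent_le (by norm_num : (1:ℝ) ≤ 16) hq
  have hV : ∀ i, (((S.powerset.filter (fun A => ‖D (X A) - y i‖ ≤ ε)).card : ℕ) : ℝ) ≤
      2 ^ S.card * Real.exp (-(N/16)) := by
    intro i
    set F := S.powerset.filter (fun A => ‖D (X A) - y i‖ ≤ ε) with hF
    rcases F.eq_empty_or_nonempty with h | ⟨A0, hA0⟩
    · rw [h]; simp; positivity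
    · have hm : ∀ A ∈ F, A ⊆ S ∧ ‖D (X A) - y i‖ ≤ ε := by
        intro A hAF
        rw [hF, Finset.mem_filter, Finset.mem_powerset] at hAF
        exact hAF
      refine (aux_code S b N (1/16) hN0.le (fun j _ => hb0 j) hNb A0 (hm A0 hA0).1 F
        (fun A hAF => ⟨(hm A hAF).1, hclose A A0 (hm A hAF).1 (hm A0 hA0).1 i (hm A hAF).2
          (hm A0 hA0).2⟩)).trans ?_
      gcongr
      nlinarith
  have hcov : S.powerset ⊆ Finset.univ.biUnion
      (fun i => S.powerset.filter (fun A => ‖D (X A) - y i‖ ≤ ε)) := by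
    intro A hAS
    obtain ⟨i, hi⟩ := hfind A (Finset.mem_powerset.1 hAS)
    exact Finset.mem_biUnion.2 ⟨i, Finset.mem_univ _, Finset.mem_filter.2 ⟨hAS, hi⟩⟩
  have h1 := (Finset.card_le_card hcov).trans Finset.card_biUnion_le
  rw [Finset.card_powerset] at h1
  have h2 : (2:ℝ) ^ S.card ≤ ∑ i : Fin n, (2:ℝ) ^ S.card * Real.exp (-(N/16)) := by
    calc (2:ℝ) ^ S.card = ((2 ^ S.card : ℕ) : ℝ) := by push_cast; rfl
      _ ≤ ((∑ i : Fin n, (S.powerset.filter (fun A => ‖D (X A) - y i‖ ≤ ε)).card : ℕ) : ℝ) := by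
        exact_mod_cast h1
      _ ≤ _ := by
        push_cast
        exact Finset.sum_le_sum (fun i _ => hV i)
  rw [Finset.sum_const, Finset.card_univ, Fintype.card_fin, nsmul_eq_mul] at h2
  have h3 : (n:ℝ) * Real.exp (-(N/16)) < 1 := by
    rw [Real.exp_neg, ← div_eq_mul_inv, div_lt_one (Real.exp_pos _)]
    exact hnM
  have h4 : (0:ℝ) < 2 ^ S.card := by positivity
  nlinarith

lemma tau_le (a : ℕ → ℝ) (ha : ∀ j, 0 < a j) (hs : Summable a) (r : ℝ) (hr : 0 < r) (E : ℕ)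
    (hE : ∀ j k : ℕ, j ≤ k → tl a j ≤ (((k:ℝ)+1)/((j:ℝ)+1))^E * tl a k)
    (j k K : ℕ) (hjk : j ≤ k) (hK : k + 1 ≤ K * (j + 1)) :
    tl a j ^ (1/r) ≤ ((K:ℝ)^E) ^ (1/r) * tl a k ^ (1/r) := by
  rw [← Real.mul_rpow (by positivity) (tl_pos a ha hs k).le]
  apply Real.rpow_le_rpow (tl_pos a ha hs j).le _ (by positivity)
  refine (hE j k hjk).trans ?_
  have := (tl_pos a ha hs k).le
  gcongr
  rw [div_le_iff₀ (by positivity)]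
  exact_mod_cast hK

/-- **Theorem 2, optimality under (AMP).**
Let `1 ≤ q < p ≤ ∞` with `1/q = 1/p + 1/r`, and let `σ` be a non-increasing sequence of
positive reals tending to zero with `∑_k σ_k^r < ∞` (here `σ k` denotes the `(k+1)`-st
term `σ_{k+1}` of the paper, and `tailSeq r.toReal σ k` is the tail `τ_{k+1}`).  Assume
(AMP): `∃ c > 0, τ_n ≥ c σ_n n^{1/r}` for all `n ≥ 1`.  Then the entropy numbers of the
diagonal operator `D_σ : ℓ_p → ℓ_q` satisfy `e_n(D_σ) ≍ τ_{⌊log₂ n⌋ + 1}`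
(note `tailSeq r.toReal σ (Nat.log 2 n)` is exactly `τ_{⌊log₂ n⌋ + 1}` of the paper). -/
theorem statement4 (p q r : ℝ≥0∞) [Fact (1 ≤ p)] [Fact (1 ≤ q)]
    (hqp : q < p) (hr : 1 / q = 1 / p + 1 / r)
    (σ : ℕ → ℝ) (hσpos : ∀ k, 0 < σ k) (hσanti : Antitone σ)
    (hσlim : Tendsto σ atTop (nhds 0))
    (hσsum : Summable (fun k : ℕ => σ k ^ r.toReal))
    (hAMP : ∃ c : ℝ, 0 < c ∧ ∀ k : ℕ,
        c * (σ k * (k + 1 : ℝ) ^ (1 / r.toReal)) ≤ tailSeq r.toReal σ k)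
    (D : lp (fun _ : ℕ => ℝ) p →L[ℝ] lp (fun _ : ℕ => ℝ) q)
    (hD : ∀ (x : lp (fun _ : ℕ => ℝ) p) (k : ℕ), D x k = σ k * x k) :
    ∃ c₁ c₂ : ℝ, 0 < c₁ ∧ 0 < c₂ ∧ ∀ n : ℕ, 1 ≤ n →
      c₁ * tailSeq r.toReal σ (Nat.log 2 n) ≤
        entropyNumber n (D '' Metric.closedBall 0 1) ∧
      entropyNumber n (D '' Metric.closedBall 0 1) ≤
        c₂ * tailSeq r.toReal σ (Nat.log 2 n) := by
  have h1p : (1 : ℝ≥0∞) ≤ p := Fact.out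
  have h1q : (1 : ℝ≥0∞) ≤ q := Fact.out
  have hqt : q ≠ ⊤ := hqp.ne_top
  have hq0 : q ≠ 0 := by rintro rfl; simp at h1q
  have hp0 : p ≠ 0 := by rintro rfl; simp at h1p
  have hqinv : 1 / q ≠ ⊤ := by simp [hq0]
  have hrinv : 1 / r ≠ ⊤ := by
    intro h; rw [h, add_top] at hr; exact hqinv hr
  have hr0 : r ≠ 0 := by rintro rfl; simp at hrinv
  have hrt : r ≠ ⊤ := by
    rintro rfl
    simp at hr
    exact hqp.ne hr
  have hpinv : 1 / p ≠ ⊤ := by simp [hp0]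
  have hq1 : 1 ≤ q.toReal := by
    simpa using ENNReal.toReal_mono hqt h1q
  have hrpos : 0 < r.toReal := ENNReal.toReal_pos hr0 hrt
  have hs : 1 / q.toReal = 1 / p.toReal + 1 / r.toReal := by
    have := congrArg ENNReal.toReal hr
    rw [ENNReal.toReal_add hpinv hrinv] at this
    simpa using this
  have hs0 : 0 ≤ 1 / p.toReal := by positivity
  have hs1 : 1 / p.toReal ≤ 1 := by
    have h1 : 1 / q.toReal ≤ 1 := by rw [div_le_one (by linarith)]; exact hq1
    have h2 : 0 < 1 / r.toReal := by positivity
    linarith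
  obtain ⟨c, hc, hA⟩ := hAMP
  have hA' : ∀ k : ℕ, c * (σ k * (k + 1 : ℝ) ^ (1 / r.toReal)) ≤
    tl (fun k => σ k ^ r.toReal) k ^ (1 / r.toReal) := hA
  have ha : ∀ j, 0 < σ j ^ r.toReal := fun j => Real.rpow_pos_of_pos (hσpos j) _
  have hA2 : ∀ k : ℕ, c ^ r.toReal * (σ k ^ r.toReal * (k + 1 : ℝ)) ≤
      tl (fun k => σ k ^ r.toReal) k := by
    intro k
    have hσk := hσpos k
    have h1 := Real.rpow_le_rpow (by positivity) (hA' k) hrpos.le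
    rw [Real.mul_rpow hc.le (by positivity), Real.mul_rpow hσk.le (by positivity),
      ← Real.rpow_mul (by positivity), ← Real.rpow_mul (tl_pos _ ha hσsum k).le,
      one_div_mul_cancel hrpos.ne', Real.rpow_one, Real.rpow_one] at h1
    exact h1
  have hc' : 0 < c ^ r.toReal := Real.rpow_pos_of_pos hc _
  obtain ⟨E, hE⟩ := tl_growth _ ha hσsum _ hc' hA2
  obtain ⟨L, hL, hcov⟩ := upper_cover p q q.toReal r.toReal (1 / p.toReal) rfl rfl hq1 hrpos hs0 hs1 hs
    σ hσpos hσsum c hc hA' E hE D hD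
  obtain ⟨K, hK⟩ := exists_nat_ge (16 / c ^ r.toReal)
  have hK1 : 16 ≤ c ^ r.toReal * K := by rwa [div_le_iff₀' hc'] at hK
  have hW : 0 < (((K+1:ℕ):ℝ)^E) ^ (1 / r.toReal) := by positivity
  have hLpos : (0:ℝ) < L := by exact_mod_cast hL
  refine ⟨1 / (32 * (((K+1:ℕ):ℝ)^E) ^ (1 / r.toReal)), 2 * ((L:ℝ)^E) ^ (1 / r.toReal),
    by positivity, by positivity, ?_⟩
  intro n hn
  set m := Nat.log 2 n with hm
  have hmn : 2 ^ m ≤ n := Nat.pow_log_le_self 2 (by omega)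
  have hnm : n < 2 ^ (m+1) := Nat.lt_pow_succ_log_self (by norm_num) n
  obtain ⟨y, hy⟩ := hcov (m / L) n
    ((Nat.pow_le_pow_right (by norm_num) (Nat.mul_div_le m L)).trans hmn)
  have hpos : 0 < 2 * tl (fun k => σ k ^ r.toReal) (m / L) ^ (1 / r.toReal) := by
    have := tl_pos _ ha hσsum (m / L)
    positivity
  have hmem : 2 * tl (fun k => σ k ^ r.toReal) (m / L) ^ (1 / r.toReal) ∈
      {ε : ℝ | 0 < ε ∧ ∃ y : Fin n → lp (fun _ : ℕ => ℝ) q,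
        D '' Metric.closedBall 0 1 ⊆ ⋃ i, Metric.closedBall (y i) ε} := ⟨hpos, y, hy⟩
  constructor
  · apply le_csInf ⟨_, hmem⟩
    rintro ε ⟨hε, y', hy'⟩
    have h1 := lower_bd p q q.toReal r.toReal (1 / p.toReal) rfl rfl hq1 hrpos hs σ hσpos hσanti hσsum
      _ hc' hA2 D hD n (K * (m+1)) (by
        calc (n:ℝ) < 2 ^ (m+1) := by exact_mod_cast hnm
          _ ≤ Real.exp 1 ^ (m+1) := by
            gcongr
            linarith [Real.exp_one_gt_d9]
          _ = Real.exp ((m+1:ℕ):ℝ) := by rw [← Real.exp_nat_mul]; simp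
          _ ≤ _ := by
            apply Real.exp_le_exp.2
            push_cast
            have : (0:ℝ) ≤ m := by positivity
            rw [le_div_iff₀ (by norm_num)]
            nlinarith) ε y' hy'
    have h2 := tau_le _ ha hσsum r.toReal hrpos E hE m ((K) * (m+1)) (K+1) (by
      have : 0 < K := by
        rcases Nat.eq_zero_or_pos K with h | h
        · rw [h] at hK1; norm_num at hK1
        · exact h
      nlinarith) (by nlinarith)
    change _ * (tl (fun k => σ k ^ r.toReal) m ^ (1 / r.toReal)) ≤ ε
    rw [one_div_mul_eq_div, div_le_iff₀ (by positivity)]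
    nlinarith
  · refine (csInf_le ⟨0, fun ε hε => hε.1.le⟩ hmem).trans ?_
    have h2 := tau_le _ ha hσsum r.toReal hrpos E hE (m / L) m L (Nat.div_le_self _ _) (by
      have := Nat.lt_mul_div_succ m hL
      omega)
    change _ ≤ _ * (tl (fun k => σ k ^ r.toReal) m ^ (1 / r.toReal))
    linarith
end
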